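/- arXiv:math/0603025 — 13 statements merged into one kernel-verified Lean document; each statement's English description precedes it below -/
import Mathlib

section
/- Let X be a normed left ℍ-module, let Y ⊆ X be an ℍ-submodule, and let x ∈ X be such that d := inf{‖y − x‖ : y ∈ Y} > 0. Then there exists f ∈ X_q* such that f(x) = 1, ‖f‖ = 1/d, and f(y) = 0 for every y ∈ Y. -/
local notation "ℍ" => Quaternion ℝ

/-- A vector at positive distance from a real subspace is separated from it by a continuous
linear functional of norm `1 / infDist`. -/
theorem exists_dual_eq_one_of_infDist_pos {E : Type*} [SeminormedAddCommGroup E] [NormedSpace ℝ E]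
    (p : Submodule ℝ E) (x : E) (hd : 0 < Metric.infDist x (p : Set E)) :
    ∃ g : E →L[ℝ] ℝ, g x = 1 ∧ ‖g‖ = 1 / Metric.infDist x (p : Set E) ∧ ∀ y ∈ p, g y = 0 := by
  set d := Metric.infDist x (p : Set E) with hd_def
  have hx : ‖(Submodule.Quotient.mk x : E ⧸ p)‖ = d :=
    QuotientAddGroup.norm_mk (S := p.toAddSubgroup) x
  obtain ⟨φ, hφ, hφx⟩ := exists_dual_vector ℝ (Submodule.Quotient.mk x : E ⧸ p)
    (hx ▸ hd.ne')
  let g₀ : E →ₗ[ℝ] ℝ := d⁻¹ • (φ.toLinearMap ∘ₗ p.mkQ)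
  have hbound : ∀ z, ‖g₀ z‖ ≤ 1 / d * ‖z‖ := fun z => by
    have h : ‖φ (Submodule.Quotient.mk z)‖ ≤ ‖z‖ :=
      calc _ ≤ ‖φ‖ * ‖(Submodule.Quotient.mk z : E ⧸ p)‖ := φ.le_opNorm _
        _ ≤ ‖z‖ := by rw [hφ, one_mul]; exact Submodule.Quotient.norm_mk_le p z
    calc ‖g₀ z‖ = d⁻¹ * ‖φ (Submodule.Quotient.mk z)‖ := by
          simp [g₀, abs_of_pos hd]
      _ ≤ 1 / d * ‖z‖ := by rw [one_div]; gcongr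
  let g : E →L[ℝ] ℝ := g₀.mkContinuous (1 / d) hbound
  have hgx : g x = 1 := by
    have : φ (Submodule.Quotient.mk x) = d := by simpa [hx] using hφx
    simp [g, g₀, this, hd.ne']
  have hgp : ∀ y ∈ p, g y = 0 := fun y hy => by
    have : (Submodule.Quotient.mk y : E ⧸ p) = 0 :=
      (Submodule.Quotient.mk_eq_zero p).mpr hy
    simp [g, g₀, this]
  refine ⟨g, hgx, le_antisymm (g₀.mkContinuous_norm_le (by positivity) hbound) ?_, hgp⟩
  have hpos : 0 < ‖g‖ := by
    have h : 1 ≤ ‖g‖ * ‖x‖ := by simpa [hgx] using g.le_opNorm x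
    exact pos_of_mul_pos_left (by linarith) (norm_nonneg x)
  rw [one_div_le hd hpos, hd_def, Metric.le_infDist ⟨0, p.zero_mem⟩]
  intro y hy
  rw [div_le_iff₀' hpos, dist_eq_norm]
  simpa [hgx, hgp y hy] using g.le_opNorm (x - y)

/-- For an ℍ-submodule `Y` of a normed left ℍ-module `X` and a vector `x` at positive
distance `d` from `Y`, there is an ℍ-quasilinear functional `f` with `f x = 1`,
`‖f‖ = 1/d` and `f = 0` on `Y`. -/
theorem stmt_1
    {X : Type*} [NormedAddCommGroup X] [NormedSpace ℝ X]
    [Module ℍ X] [IsScalarTower ℝ ℍ X]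
    (hnorm : ∀ (a : ℍ) (x : X), ‖a • x‖ = ‖a‖ * ‖x‖)
    (Y : Submodule ℍ X) (x : X)
    (hd : 0 < Metric.infDist x (Y : Set X)) :
    ∃ f : X →L[ℝ] ℍ, f x = 1 ∧ ‖f‖ = 1 / Metric.infDist x (Y : Set X) ∧
      ∀ y ∈ Y, f y = 0 := by
  obtain ⟨g, hgx, hg, hgY⟩ := exists_dual_eq_one_of_infDist_pos (Y.restrictScalars ℝ) x hd
  let ι : ℝ →ₗᵢ[ℝ] ℍ := ⟨Algebra.linearMap ℝ ℍ, fun r => norm_algebraMap' ℍ r⟩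
  refine ⟨ι.toContinuousLinearMap.comp g, ?_, ?_, fun y hy => ?_⟩
  · change algebraMap ℝ ℍ (g x) = 1
    rw [hgx, map_one]
  · rw [ι.norm_toContinuousLinearMap_comp, hg]
    rfl
  · simp [hgY y hy]
end

section
/- Let X be a normed left ℍ-module, let Y ⊆ X be a closed ℍ-submodule, and let x ∈ X with x ∉ Y. Then there exists f ∈ X_q* such that f(x) = 1 and f(y) = 0 for every y ∈ Y. -/
local notation "ℍ" => Quaternion ℝ

/-- A point outside a closed real subspace can be sent to `1` by a continuous linear functional
vanishing on the subspace. -/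
theorem Submodule.exists_continuousLinearMap_eq_one_of_notMem {E : Type*} [NormedAddCommGroup E]
    [NormedSpace ℝ E] (S : Submodule ℝ E) (hS : IsClosed (S : Set E)) {x : E} (hx : x ∉ S) :
    ∃ g : E →L[ℝ] ℝ, g x = 1 ∧ ∀ y ∈ S, g y = 0 := by
  have : IsClosed (S : Set E) := hS
  have hx' : S.mkQ x ≠ 0 := by simpa using hx
  obtain ⟨g, hg⟩ := SeparatingDual.exists_eq_one (R := ℝ) hx'
  refine ⟨g.comp S.mkQL, hg, fun y hy => ?_⟩
  have hy' : S.mkQ y = 0 := by simpa using hy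
  exact (congrArg g hy').trans (map_zero g)

/-- For a closed ℍ-submodule `Y` of a normed left ℍ-module `X` and a vector `x ∉ Y`,
there is an ℍ-quasilinear functional `f` with `f x = 1` vanishing on `Y`. -/
theorem stmt_2
    {X : Type*} [NormedAddCommGroup X] [NormedSpace ℝ X]
    [Module ℍ X] [IsScalarTower ℝ ℍ X]
    (hnorm : ∀ (a : ℍ) (x : X), ‖a • x‖ = ‖a‖ * ‖x‖)
    (Y : Submodule ℍ X) (hY : IsClosed (Y : Set X)) (x : X) (hx : x ∉ Y) :
    ∃ f : X →L[ℝ] ℍ, f x = 1 ∧ ∀ y ∈ Y, f y = 0 := by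
  obtain ⟨g, hgx, hgY⟩ :=
    (Y.restrictScalars ℝ).exists_continuousLinearMap_eq_one_of_notMem hY hx
  exact ⟨g.smulRight 1, by simp [hgx], fun y hy => by simp [hgY y hy]⟩
end

section
/- Let X be a normed left ℍ-module. For every x ∈ X one has ‖x‖ = sup{‖f(x)‖ : f ∈ X_q*, ‖f‖ ≤ 1}. Moreover, if x, y ∈ X satisfy f(x) = f(y) for every f ∈ X_q*, then x = y. -/
local notation "ℍ" => Quaternion ℝ

/-- Every vector is normed by a functional in the closed unit ball with values in a given
real normed space that has a unit vector. -/
theorem exists_continuousLinearMap_norm_le_one_norm_apply_eq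
    {E F : Type*} [NormedAddCommGroup E] [NormedSpace ℝ E]
    [NormedAddCommGroup F] [NormedSpace ℝ F] {u : F} (hu : ‖u‖ = 1) (x : E) :
    ∃ f : E →L[ℝ] F, ‖f‖ ≤ 1 ∧ ‖f x‖ = ‖x‖ := by
  obtain ⟨g, hg, hgx⟩ := exists_dual_vector'' ℝ x
  refine ⟨g.smulRight u, ?_, ?_⟩
  · simpa [ContinuousLinearMap.norm_smulRight_apply, hu] using hg
  · simp [norm_smul, hu, hgx]

/-- In a normed left ℍ-module, the norm of a vector is the supremum of `‖f x‖` over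
ℍ-quasilinear functionals `f` in the closed unit ball, and the quasilinear
functionals separate points. -/
theorem stmt_3
    {X : Type*} [NormedAddCommGroup X] [NormedSpace ℝ X]
    [Module ℍ X] [IsScalarTower ℝ ℍ X]
    (hnorm : ∀ (a : ℍ) (x : X), ‖a • x‖ = ‖a‖ * ‖x‖) :
    (∀ x : X, ‖x‖ = sSup {r : ℝ | ∃ f : X →L[ℝ] ℍ, ‖f‖ ≤ 1 ∧ r = ‖f x‖}) ∧
    ∀ x y : X, (∀ f : X →L[ℝ] ℍ, f x = f y) → x = y := by
  have norming (x : X) : ∃ f : X →L[ℝ] ℍ, ‖f‖ ≤ 1 ∧ ‖f x‖ = ‖x‖ :=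
    exists_continuousLinearMap_norm_le_one_norm_apply_eq norm_one x
  refine ⟨fun x => ?_, fun x y hxy => ?_⟩
  · obtain ⟨f, hf, hfx⟩ := norming x
    symm
    apply IsGreatest.csSup_eq
    refine ⟨⟨f, hf, hfx.symm⟩, ?_⟩
    rintro _ ⟨g, hg, rfl⟩
    exact g.le_of_opNorm_le hg x |>.trans_eq (one_mul _)
  · obtain ⟨f, -, hf⟩ := norming (x - y)
    rw [map_sub, hxy f, sub_self, norm_zero] at hf
    exact sub_eq_zero.mp (norm_eq_zero.mp hf.symm)
end

section
/- Let X and Y be complete normed left ℍ-modules, let T : X → Y be a continuous ℝ-linear map, and let T* : Y_q* → X_q*, T*(g) = g ∘ T, be its adjoint. Then the following are equivalent: (1) T is bijective and its inverse T⁻¹ : Y → X is a continuous ℝ-linear map defined on all of Y; (2) T* is bijective and its inverse (T*)⁻¹ : X_q* → Y_q* is a continuous ℝ-linear map defined on all of X_q*. -/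
local notation "ℍ" => Quaternion ℝ

section Adjoint

variable {E F G : Type*} [NormedAddCommGroup E] [NormedSpace ℝ E]
  [NormedAddCommGroup F] [NormedSpace ℝ F] [NormedAddCommGroup G] [NormedSpace ℝ G]

/-- Precomposition with `T` admitting a bounded left inverse bounds `T` from below. -/
theorem antilipschitzWith_of_comp_leftInverse {T : E →L[ℝ] F} {e : G} (he : ‖e‖ = 1)
    (U : (E →L[ℝ] G) →L[ℝ] (F →L[ℝ] G)) (hU : ∀ f : E →L[ℝ] G, (U f).comp T = f) :
    AntilipschitzWith ‖U‖₊ T := by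
  refine T.antilipschitz_of_bound fun x => ?_
  obtain ⟨φ, hφ, hφx⟩ := exists_dual_vector'' ℝ x
  have hφe : ‖φ.smulRight e‖ ≤ 1 := by
    rwa [ContinuousLinearMap.norm_smulRight_apply, he, mul_one]
  calc ‖x‖ = ‖φ.smulRight e x‖ := by simp [hφx, norm_smul, he]
    _ = ‖U (φ.smulRight e) (T x)‖ := by
      rw [← ContinuousLinearMap.comp_apply, hU]
    _ ≤ ‖U (φ.smulRight e)‖ * ‖T x‖ := ContinuousLinearMap.le_opNorm _ _
    _ ≤ ‖U‖ * ‖T x‖ := by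
      gcongr
      exact (U.le_opNorm_of_le hφe).trans_eq (mul_one _)

/-- A subspace on which no nonzero continuous functional vanishes is dense. -/
theorem Submodule.topologicalClosure_eq_top_of_forall_dual (p : Submodule ℝ F)
    (h : ∀ φ : F →L[ℝ] ℝ, (∀ y ∈ p, φ y = 0) → φ = 0) : p.topologicalClosure = ⊤ := by
  rw [Submodule.eq_top_iff']
  by_contra! hp
  obtain ⟨y, hy⟩ := hp
  obtain ⟨φ, u, hφ, huy⟩ := geometric_hahn_banach_closed_point
    p.topologicalClosure.convex p.isClosed_topologicalClosure hy
  have hu : 0 < u := by simpa using hφ 0 (zero_mem _)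
  have hφp : ∀ z ∈ p, φ z = 0 := by
    intro z hz
    by_contra hne
    have hlt := hφ ((u / φ z) • z)
      (p.le_topologicalClosure (p.smul_mem _ hz))
    rw [map_smul, smul_eq_mul, div_mul_cancel₀ _ hne] at hlt
    exact lt_irrefl _ hlt
  rw [h φ hφp, zero_apply] at huy
  exact hu.not_gt huy

/-- An operator whose precomposition map is injective has dense range. -/
theorem topologicalClosure_range_eq_top_of_comp_injective [Nontrivial G] {T : E →L[ℝ] F}
    (hT : Function.Injective fun g : F →L[ℝ] G => g.comp T) :
    T.range.topologicalClosure = ⊤ := by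
  obtain ⟨e, he⟩ := exists_ne (0 : G)
  refine Submodule.topologicalClosure_eq_top_of_forall_dual _ fun φ hφ => ?_
  have hφe : φ.smulRight e = 0 := hT <| by
    ext x
    simp [hφ (T x) ⟨x, rfl⟩]
  ext y
  simpa [he] using DFunLike.congr_fun hφe y

end Adjoint

/-- For complete normed left ℍ-modules `X`, `Y` and a continuous ℝ-linear map
`T : X → Y`, `T` has a continuous everywhere-defined inverse iff its adjoint
`T* : Y_q* → X_q*`, `T*(g) = g ∘ T`, has a continuous everywhere-defined inverse. -/
theorem stmt_5
    {X Y : Type*} [NormedAddCommGroup X] [NormedSpace ℝ X]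
    [Module ℍ X] [IsScalarTower ℝ ℍ X] [CompleteSpace X]
    [NormedAddCommGroup Y] [NormedSpace ℝ Y]
    [Module ℍ Y] [IsScalarTower ℝ ℍ Y] [CompleteSpace Y]
    (hnormX : ∀ (a : ℍ) (x : X), ‖a • x‖ = ‖a‖ * ‖x‖)
    (hnormY : ∀ (a : ℍ) (y : Y), ‖a • y‖ = ‖a‖ * ‖y‖)
    (T : X →L[ℝ] Y) :
    (∃ S : Y →L[ℝ] X, (∀ x : X, S (T x) = x) ∧ (∀ y : Y, T (S y) = y)) ↔
    (∃ U : (X →L[ℝ] ℍ) →L[ℝ] (Y →L[ℝ] ℍ),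
      (∀ g : Y →L[ℝ] ℍ, U (g.comp T) = g) ∧ (∀ f : X →L[ℝ] ℍ, (U f).comp T = f)) := by
  constructor
  · rintro ⟨S, hST, hTS⟩
    refine ⟨ContinuousLinearMap.precomp ℍ S, fun g => ?_, fun f => ?_⟩
    · ext1 y
      simp [hTS]
    · ext1 x
      simp [hST]
  · rintro ⟨U, hUT, hTU⟩
    have hbij : Function.Bijective T :=
      T.bijective_iff_dense_range_and_antilipschitz.2
        ⟨topologicalClosure_range_eq_top_of_comp_injective
            (Function.LeftInverse.injective (g := U) hUT),
          _, antilipschitzWith_of_comp_leftInverse (norm_one (α := ℍ)) U hTU⟩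
    let e := ContinuousLinearEquiv.ofBijective T
      (LinearMap.ker_eq_bot.2 hbij.1) (LinearMap.range_eq_top.2 hbij.2)
    exact ⟨e.symm, e.symm_apply_apply, e.apply_symm_apply⟩
end

section
/- Let X be a complete normed left ℍ-module, let T be an ℝ-linear operator defined on a subspace D(T) ⊆ X, and let z₀ ∈ ρ(T) with R₀ := R(z₀;T). Then every z ∈ ℍ with ‖z − z₀‖·‖R₀‖ < 1 belongs to ρ(T), and R(z;T) = R₀ ∘ (Σ_{n=0}^∞ (M_{z₀ − z} ∘ R₀)ⁿ), the series converging in operator norm. In particular, the resolvent set ρ(T) is an open subset of ℍ. -/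
local notation "ℍ" => Quaternion ℝ

section

variable {X : Type*} [NormedAddCommGroup X] [NormedSpace ℝ X]
  [Module ℍ X] [IsScalarTower ℝ ℍ X]

/-- For `w : ℍ`, the continuous ℝ-linear map `M_w : X → X`, `x ↦ w • x`, on a normed
left ℍ-module `X`. -/
noncomputable def smulCLM (hnorm : ∀ (a : ℍ) (x : X), ‖a • x‖ = ‖a‖ * ‖x‖) (w : ℍ) :
    X →L[ℝ] X :=
  LinearMap.mkContinuous
    { toFun := fun x => w • x
      map_add' := fun x y => smul_add w x y
      map_smul' := fun a x => by
        simp only [RingHom.id_apply]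
        rw [← algebraMap_smul ℍ a x, ← algebraMap_smul ℍ a (w • x), ← mul_smul, ← mul_smul,
          Algebra.commutes] }
    ‖w‖ (fun x => le_of_eq (hnorm w x))

/-- The resolvent set of an ℝ-linear operator `T` defined on the subspace `D ⊆ X`:
the set of `z : ℍ` admitting a continuous ℝ-linear `R : X → X` with range in `D`,
`z • (R x) − T (R x) = x` for all `x`, and `R (z • y − T y) = y` for all `y ∈ D`. -/
def qResolventSet (D : Submodule ℝ X) (T : D →ₗ[ℝ] X) : Set ℍ :=
  {z : ℍ | ∃ R : X →L[ℝ] X, ∃ hmem : ∀ x, R x ∈ D,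
    (∀ x : X, z • R x - T ⟨R x, hmem x⟩ = x) ∧
    (∀ y : D, R (z • (y : X) - T y) = (y : X))}

theorem norm_smulCLM_comp_lt_one (hnorm : ∀ (a : ℍ) (x : X), ‖a • x‖ = ‖a‖ * ‖x‖)
    {z₀ z : ℍ} {R₀ : X →L[ℝ] X} (hz : ‖z - z₀‖ * ‖R₀‖ < 1) :
    ‖(smulCLM hnorm (z₀ - z)).comp R₀‖ < 1 := by
  refine lt_of_le_of_lt (ContinuousLinearMap.opNorm_comp_le _ _) (lt_of_le_of_lt ?_ hz)
  rw [norm_sub_rev z z₀]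
  gcongr
  exact LinearMap.mkContinuous_norm_le _ (norm_nonneg _) _

/-- The Neumann series of a resolvent at `z₀` is a resolvent at every `z` close to `z₀`. -/
theorem neumannSeries_isResolvent [CompleteSpace X]
    (hnorm : ∀ (a : ℍ) (x : X), ‖a • x‖ = ‖a‖ * ‖x‖)
    (D : Submodule ℝ X) (T : D →ₗ[ℝ] X) (z₀ : ℍ) (R₀ : X →L[ℝ] X)
    (hmem₀ : ∀ x, R₀ x ∈ D)
    (h₀a : ∀ x : X, z₀ • R₀ x - T ⟨R₀ x, hmem₀ x⟩ = x)
    (h₀b : ∀ y : D, R₀ (z₀ • (y : X) - T y) = (y : X))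
    (z : ℍ) (hz : ‖z - z₀‖ * ‖R₀‖ < 1) :
    ∃ R : X →L[ℝ] X, ∃ hmem : ∀ x, R x ∈ D,
      (∀ x : X, z • R x - T ⟨R x, hmem x⟩ = x) ∧
      (∀ y : D, R (z • (y : X) - T y) = (y : X)) ∧
      R = R₀.comp (∑' n : ℕ, ((smulCLM hnorm (z₀ - z)).comp R₀) ^ n) := by
  have hA := norm_smulCLM_comp_lt_one hnorm hz
  set A := (smulCLM hnorm (z₀ - z)).comp R₀
  have hA_apply (x : X) : A x = z₀ • R₀ x - z • R₀ x := sub_smul z₀ z (R₀ x)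
  have hleft (x : X) : (∑' n : ℕ, A ^ n) (x - A x) = x :=
    DFunLike.congr_fun (geom_series_mul_neg A hA) x
  have hright (x : X) : (∑' n : ℕ, A ^ n) x - A ((∑' n : ℕ, A ^ n) x) = x :=
    DFunLike.congr_fun (mul_neg_geom_series A hA) x
  refine ⟨R₀.comp (∑' n : ℕ, A ^ n), fun x => hmem₀ _, fun x => ?_, fun y => ?_, rfl⟩
  · have h := h₀a ((∑' n : ℕ, A ^ n) x)
    have h' := hright x
    rw [hA_apply] at h'
    simp only [ContinuousLinearMap.comp_apply]
    calc _ = (z₀ • R₀ ((∑' n : ℕ, A ^ n) x) - T ⟨_, hmem₀ ((∑' n : ℕ, A ^ n) x)⟩)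
          - (z₀ • R₀ ((∑' n : ℕ, A ^ n) x) - z • R₀ ((∑' n : ℕ, A ^ n) x)) := by abel
      _ = x := by rw [h, h']
  · have hw : z • (y : X) - T y = (z₀ • (y : X) - T y) - A (z₀ • (y : X) - T y) := by
      rw [hA_apply, h₀b]
      abel
    rw [ContinuousLinearMap.comp_apply, hw, hleft, h₀b]

/-- Neumann series for the resolvent: if `z₀` is in the resolvent set with resolvent
`R₀`, then every `z` with `‖z − z₀‖·‖R₀‖ < 1` is in the resolvent set, with resolvent
`R₀ ∘ Σₙ (M_{z₀−z} ∘ R₀)ⁿ`; in particular the resolvent set is open. -/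
theorem stmt_7 [CompleteSpace X]
    (hnorm : ∀ (a : ℍ) (x : X), ‖a • x‖ = ‖a‖ * ‖x‖)
    (D : Submodule ℝ X) (T : D →ₗ[ℝ] X) (z₀ : ℍ) (R₀ : X →L[ℝ] X)
    (hmem₀ : ∀ x, R₀ x ∈ D)
    (h₀a : ∀ x : X, z₀ • R₀ x - T ⟨R₀ x, hmem₀ x⟩ = x)
    (h₀b : ∀ y : D, R₀ (z₀ • (y : X) - T y) = (y : X)) :
    (∀ z : ℍ, ‖z - z₀‖ * ‖R₀‖ < 1 →
      ∃ R : X →L[ℝ] X, ∃ hmem : ∀ x, R x ∈ D,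
        (∀ x : X, z • R x - T ⟨R x, hmem x⟩ = x) ∧
        (∀ y : D, R (z • (y : X) - T y) = (y : X)) ∧
        R = R₀.comp (∑' n : ℕ, ((smulCLM hnorm (z₀ - z)).comp R₀) ^ n)) ∧
    IsOpen (qResolventSet D T) := by
  refine ⟨neumannSeries_isResolvent hnorm D T z₀ R₀ hmem₀ h₀a h₀b,
    isOpen_iff_mem_nhds.2 ?_⟩
  rintro z₁ ⟨R₁, hmem₁, h₁a, h₁b⟩
  have hopen : IsOpen {z : ℍ | ‖z - z₁‖ * ‖R₁‖ < 1} :=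
    isOpen_lt (by fun_prop) continuous_const
  filter_upwards [hopen.mem_nhds (by simp : ‖z₁ - z₁‖ * ‖R₁‖ < 1)] with z hz
  obtain ⟨R, hmem, ha, hb, -⟩ :=
    neumannSeries_isResolvent hnorm D T z₁ R₁ hmem₁ h₁a h₁b z hz
  exact ⟨R, hmem, ha, hb⟩

end
end

section
/- Let 𝒜 be a Banach algebra over ℍ with scalar embedding φ, and let x ∈ 𝒜 commute with φ(z) for every z ∈ ℍ. Then: the ℍ-spectrum σ(x) is a nonempty compact subset of ℍ; for all y, z ∈ ρ(x) the resolvent identity R(z;x) − R(y;x) = R(z;x) · φ(y − z) · R(y;x) holds; and whenever ‖z‖ > ‖x‖ one has z ∈ ρ(x) with ‖R(z;x)‖ ≤ (‖z‖ − ‖x‖)⁻¹, so that ‖R(z;x)‖ → 0 as ‖z‖ → ∞. -/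
local notation "ℍ" => Quaternion ℝ

/-- The ℍ-spectrum of an element `x` of a Banach algebra over ℍ with scalar
embedding `φ`. -/
def qSpectrum {A : Type*} [NormedRing A] [NormedAlgebra ℝ A]
    (φ : ℍ →ₐ[ℝ] A) (x : A) : Set ℍ :=
  {z : ℍ | ¬ IsUnit (φ z - x)}

theorem norm_coeComplex (z : ℂ) : ‖(z : ℍ)‖ = ‖z‖ := by
  rw [← sq_eq_sq₀ (norm_nonneg _) (norm_nonneg _), sq ‖(z : ℍ)‖,
    ← Quaternion.normSq_eq_norm_mul_self, Complex.sq_norm, Complex.normSq_apply,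
    Quaternion.normSq_def']
  simp [sq]

theorem exists_coeComplex_not_isUnit_sub {A : Type*} [NormedRing A] [NormedAlgebra ℝ A]
    [CompleteSpace A] [NormOneClass A] (φ : ℍ →ₐ[ℝ] A) (hφ : ∀ z : ℍ, ‖φ z‖ = ‖z‖)
    (x : A) (hx : ∀ z : ℂ, x * φ z = φ z * x) :
    ∃ z : ℂ, ¬ IsUnit (φ z - x) := by
  let ψ : ℂ →ₐ[ℝ] A := φ.comp Quaternion.ofComplex
  let C : Subalgebra ℝ A := Subalgebra.centralizer ℝ (Set.range ψ)
  have mem_C {a : A} : a ∈ C ↔ ∀ z, ψ z * a = a * ψ z := by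
    simp [C, Subalgebra.mem_centralizer_iff]
  have hC : IsClosed (C : Set A) := by
    simpa [C] using Set.isClosed_centralizer (Set.range ψ)
  have : CompleteSpace C := hC.completeSpace_coe
  let ι : ℂ →+* C := (ψ.codRestrict C fun w ↦ mem_C.2 fun z ↦ by
    rw [← map_mul, ← map_mul, mul_comm]).toRingHom
  let _ : Algebra ℂ C := ι.toAlgebra' fun z a ↦ Subtype.ext (mem_C.1 a.2 z)
  let _ : NormedAlgebra ℂ C :=
    { norm_smul_le := fun z a ↦ by
        change ‖ι z * a‖ ≤ _
        refine (norm_mul_le _ _).trans_eq ?_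
        rw [← norm_coeComplex z, ← hφ]
        rfl }
  have hxC : x ∈ C := mem_C.2 fun z ↦ (hx z).symm
  have : Nontrivial A := NormOneClass.nontrivial (G := A)
  obtain ⟨z, hz⟩ := spectrum.nonempty (⟨x, hxC⟩ : C)
  refine ⟨z, fun hu ↦ spectrum.mem_iff.1 hz ?_⟩
  obtain ⟨u, hu⟩ := hu
  have hmem : (u : A) ∈ C := by
    rw [hu]
    exact sub_mem (ι z).2 hxC
  have hinv : (↑u⁻¹ : A) ∈ C := mem_C.2 fun w ↦ by
    have : Commute (ψ w) u := mem_C.1 hmem w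
    exact this.units_inv_right
  have hval : algebraMap ℂ C z - ⟨x, hxC⟩ = ⟨u, hmem⟩ := Subtype.ext hu.symm
  rw [hval]
  exact ⟨⟨⟨u, hmem⟩, ⟨↑u⁻¹, hinv⟩, Subtype.ext u.mul_inv, Subtype.ext u.inv_mul⟩, rfl⟩

theorem isUnit_sub_of_norm_lt {A : Type*} [NormedRing A] [NormedAlgebra ℝ A]
    [CompleteSpace A] (φ : ℍ →ₐ[ℝ] A) (hφ : ∀ z : ℍ, ‖φ z‖ = ‖z‖)
    {x : A} {z : ℍ} (hz : ‖x‖ < ‖z‖) : IsUnit (φ z - x) := by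
  have hpos : 0 < ‖z‖ := (norm_nonneg x).trans_lt hz
  have hz0 : z ≠ 0 := norm_pos_iff.1 hpos
  have hlt : ‖φ z⁻¹ * x‖ < 1 := by
    refine (norm_mul_le _ _).trans_lt ?_
    rw [hφ, norm_inv, inv_mul_lt_iff₀ hpos, mul_one]
    exact hz
  have heq : φ z - x = φ z * (1 - φ z⁻¹ * x) := by
    rw [mul_sub, mul_one, ← mul_assoc, ← map_mul, mul_inv_cancel₀ hz0, map_one, one_mul]
  rw [heq]
  exact ((IsUnit.mk0 z hz0).map φ).mul (isUnit_one_sub_of_norm_lt_one hlt)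

theorem norm_inverse_sub_le {A : Type*} [NormedRing A] [NormedAlgebra ℝ A]
    [CompleteSpace A] [NormOneClass A] (φ : ℍ →ₐ[ℝ] A) (hφ : ∀ z : ℍ, ‖φ z‖ = ‖z‖)
    {x : A} {z : ℍ} (hz : ‖x‖ < ‖z‖) :
    ‖Ring.inverse (φ z - x)‖ ≤ (‖z‖ - ‖x‖)⁻¹ := by
  have hpos : 0 < ‖z‖ := (norm_nonneg x).trans_lt hz
  have hz0 : z ≠ 0 := norm_pos_iff.1 hpos
  have hR := Ring.mul_inverse_cancel _ (isUnit_sub_of_norm_lt φ hφ hz)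
  set R := Ring.inverse (φ z - x)
  have hzR : φ z * R = 1 + x * R := by rw [← hR]; noncomm_ring
  have hle : ‖z‖ * ‖R‖ ≤ ‖φ z * R‖ := by
    have hRz : R = φ z⁻¹ * (φ z * R) := by
      rw [← mul_assoc, ← map_mul, inv_mul_cancel₀ hz0, map_one, one_mul]
    have := norm_mul_le (φ z⁻¹) (φ z * R)
    rwa [← hRz, hφ, norm_inv, le_inv_mul_iff₀ hpos] at this
  have hub : ‖φ z * R‖ ≤ 1 + ‖x‖ * ‖R‖ := by
    rw [hzR]
    exact (norm_add_le _ _).trans (add_le_add norm_one.le (norm_mul_le _ _))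
  rw [← one_div, le_div_iff₀ (sub_pos.2 hz)]
  linarith

theorem isCompact_qSpectrum {A : Type*} [NormedRing A] [NormedAlgebra ℝ A]
    [CompleteSpace A] (φ : ℍ →ₐ[ℝ] A) (hφ : ∀ z : ℍ, ‖φ z‖ = ‖z‖) (x : A) :
    IsCompact (qSpectrum φ x) := by
  have : ProperSpace ℍ := FiniteDimensional.proper_real ℍ
  have hcont : Continuous fun z ↦ φ z - x :=
    (AddMonoidHomClass.isometry_of_norm φ hφ).continuous.sub continuous_const
  refine Metric.isCompact_of_isClosed_isBounded ?_ ?_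
  · exact (Units.isOpen.preimage hcont).isClosed_compl
  · refine (Metric.isBounded_closedBall (x := 0) (r := ‖x‖)).subset fun z hz ↦ ?_
    rw [mem_closedBall_zero_iff]
    exact not_lt.1 fun h ↦ hz (isUnit_sub_of_norm_lt φ hφ h)

/-- For an element `x` of a Banach algebra over ℍ commuting with all quaternion
scalars: the ℍ-spectrum of `x` is nonempty and compact, the resolvent identity
holds, and for `‖z‖ > ‖x‖` one has `z ∈ ρ(x)` with
`‖R(z;x)‖ ≤ (‖z‖ − ‖x‖)⁻¹`, so `‖R(z;x)‖ → 0` as `‖z‖ → ∞`. -/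
theorem stmt_8 {A : Type*} [NormedRing A] [NormedAlgebra ℝ A] [CompleteSpace A]
    [NormOneClass A]
    (φ : ℍ →ₐ[ℝ] A) (hφ : ∀ z : ℍ, ‖φ z‖ = ‖z‖)
    (x : A) (hx : ∀ z : ℍ, x * φ z = φ z * x) :
    (qSpectrum φ x).Nonempty ∧ IsCompact (qSpectrum φ x) ∧
    (∀ y z : ℍ, y ∉ qSpectrum φ x → z ∉ qSpectrum φ x →
      Ring.inverse (φ z - x) - Ring.inverse (φ y - x) =
        Ring.inverse (φ z - x) * φ (y - z) * Ring.inverse (φ y - x)) ∧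
    (∀ z : ℍ, ‖x‖ < ‖z‖ → z ∉ qSpectrum φ x ∧
      ‖Ring.inverse (φ z - x)‖ ≤ (‖z‖ - ‖x‖)⁻¹) ∧
    Filter.Tendsto (fun z : ℍ => ‖Ring.inverse (φ z - x)‖)
      (Filter.comap (fun z : ℍ => ‖z‖) Filter.atTop) (nhds 0) := by
  refine ⟨?_, isCompact_qSpectrum φ hφ x, fun y z hy hz ↦ ?_, fun z hz ↦
    ⟨not_not.2 (isUnit_sub_of_norm_lt φ hφ hz), norm_inverse_sub_le φ hφ hz⟩, ?_⟩
  · obtain ⟨z, hz⟩ := exists_coeComplex_not_isUnit_sub φ hφ x fun z ↦ hx z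
    exact ⟨z, hz⟩
  · have hyx : φ (y - z) = (φ y - x) - (φ z - x) := by rw [map_sub]; abel
    rw [hyx, mul_sub, sub_mul, mul_assoc, Ring.mul_inverse_cancel _ (not_not.1 hy),
      Ring.inverse_mul_cancel _ (not_not.1 hz), mul_one, one_mul]
  · have hnorm : Filter.Tendsto (fun z : ℍ ↦ ‖z‖) (Filter.comap (fun z : ℍ ↦ ‖z‖) Filter.atTop)
        Filter.atTop := Filter.tendsto_comap
    have hlim := tendsto_inv_atTop_zero.comp
      (Filter.tendsto_atTop_add_const_right _ (-‖x‖) hnorm)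
    refine squeeze_zero' (.of_forall fun _ ↦ norm_nonneg _) ?_ hlim
    filter_upwards [hnorm.eventually_gt_atTop ‖x‖] with z hz
    simpa [sub_eq_add_neg] using norm_inverse_sub_le φ hφ hz
end

section
/- Let 𝒜 be a Banach algebra over ℍ with scalar embedding φ, and let A, B ∈ 𝒜 be elements that commute with each other (A·B = B·A) and each of which commutes with φ(z) for every z ∈ ℍ. Then r(A·B) ≤ r(A)·r(B) and r(A + B) ≤ r(A) + r(B). -/
local notation "ℍ" => Quaternion ℝ

/-- The spectral radius `r(x) = sup{‖z‖ : z ∈ σ(x)}` of an element of a Banach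
algebra over ℍ. -/
noncomputable def qSpectralRadius {A : Type*} [NormedRing A] [NormedAlgebra ℝ A]
    (φ : ℍ →ₐ[ℝ] A) (x : A) : ℝ :=
  sSup {r : ℝ | ∃ z ∈ qSpectrum φ x, r = ‖z‖}

/-- A non-invertible element of a commutative, closed, inverse-closed subring `D` containing a
copy of `ℂ` is detected by a character of `D`, whose values lie in the spectra. -/
theorem Subring.exists_ringHom_complex_of_not_isUnit {A : Type*} [NormedRing A] [CompleteSpace A]
    (D : Subring A) (hD : IsClosed (D : Set A)) (hcomm : ∀ x ∈ D, ∀ y ∈ D, x * y = y * x)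
    (hinv : ∀ u : Aˣ, (u : A) ∈ D → (↑u⁻¹ : A) ∈ D)
    (ι : ℂ →+* D) (hι : ∀ c, ‖(ι c : A)‖ ≤ ‖c‖) (c : ℂ) (x : D)
    (hx : ¬ IsUnit ((ι c : A) - x)) :
    ∃ f : D →+* ℂ, f x = c ∧ ∀ y : D, ¬ IsUnit ((ι (f y) : A) - y) := by
  let _ : NormedCommRing D :=
    { (inferInstance : NormedRing D) with
      mul_comm := fun x y => Subtype.ext (hcomm x x.2 y y.2) }
  let _ : Algebra ℂ D := ι.toAlgebra
  let _ : NormedAlgebra ℂ D :=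
    { (inferInstance : Algebra ℂ D) with
      norm_smul_le := fun r d =>
        (norm_mul_le (ι r : A) (d : A)).trans (by gcongr; exacts [hι r, le_rfl]) }
  have : CompleteSpace D := hD.completeSpace_coe
  have hx' : ¬ IsUnit (ι c - x) := fun h => hx (h.map D.subtype)
  obtain ⟨f, hf⟩ := WeakDual.CharacterSpace.mem_spectrum_iff_exists.1
    (show c ∈ spectrum ℂ x from hx')
  refine ⟨(WeakDual.CharacterSpace.equivAlgHom f : D →ₐ[ℂ] ℂ).toRingHom, hf, fun y hy => ?_⟩
  have hmem : f y ∈ spectrum ℂ y := WeakDual.CharacterSpace.mem_spectrum_iff_exists.2 ⟨f, rfl⟩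
  obtain ⟨u, hu⟩ := hy
  have huD : (u : A) ∈ D := hu ▸ (ι (f y) - y).2
  refine hmem (show IsUnit (ι (f y) - y) from ⟨⟨ι (f y) - y, ⟨_, hinv u huD⟩, ?_, ?_⟩, rfl⟩)
  · exact Subtype.ext (by simp [hu])
  · exact Subtype.ext (by simp [hu])

/-- Every commuting set in a normed ring is contained in a commutative, closed,
inverse-closed subring, namely its bicommutant. -/
theorem exists_closed_comm_subring_of_comm {A : Type*} [NormedRing A] (S : Set A)
    (hS : ∀ x ∈ S, ∀ y ∈ S, x * y = y * x) :
    ∃ D : Subring A, S ⊆ D ∧ IsClosed (D : Set A) ∧ (∀ x ∈ D, ∀ y ∈ D, x * y = y * x) ∧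
      ∀ u : Aˣ, (u : A) ∈ D → (↑u⁻¹ : A) ∈ D := by
  refine ⟨Subring.centralizer S.centralizer, Set.subset_centralizer_centralizer,
    Set.isClosed_centralizer _, Set.centralizer_centralizer_comm_of_comm hS, ?_⟩
  intro u hu m hm
  exact (Commute.units_inv_right (show Commute m (u : A) from hu m hm)).eq

/-- Every quaternion is conjugate to a complex number. -/
theorem Quaternion.exists_mul_eq_coeComplex_mul (z : ℍ) :
    ∃ (u : ℍ) (c : ℂ), u ≠ 0 ∧ u * z = (c : ℍ) * u := by
  by_cases hz : z.imJ = 0 ∧ z.imK = 0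
  · refine ⟨1, ⟨z.re, z.imI⟩, one_ne_zero, ?_⟩
    ext <;> simp [hz.1, hz.2]
  · let n := √(z.imI ^ 2 + z.imJ ^ 2 + z.imK ^ 2)
    have hn2 : n * n = z.imI ^ 2 + z.imJ ^ 2 + z.imK ^ 2 := Real.mul_self_sqrt (by positivity)
    obtain ⟨u, hre, hI, hJ, hK⟩ : ∃ u : ℍ, u.re = 0 ∧ u.imI = z.imI + n ∧ u.imJ = z.imJ ∧
      u.imK = z.imK := ⟨⟨0, z.imI + n, z.imJ, z.imK⟩, rfl, rfl, rfl, rfl⟩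
    refine ⟨u, ⟨z.re, n⟩, ?_, ?_⟩
    · rintro rfl
      exact hz ⟨hJ.symm, hK.symm⟩
    · ext <;> simp [hre, hI, hJ, hK] <;> linarith

theorem Quaternion.norm_coeComplex (c : ℂ) : ‖(c : ℍ)‖ = ‖c‖ := by
  rw [← sq_eq_sq₀ (norm_nonneg _) (norm_nonneg _), sq, ← Quaternion.normSq_eq_norm_mul_self,
    Complex.sq_norm, Quaternion.normSq_def', Complex.normSq_apply]
  simp [sq]

section

variable {A : Type*} [NormedRing A] [NormedAlgebra ℝ A] (φ : ℍ →ₐ[ℝ] A)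

/-- For an element commuting with the scalars, every modulus attained on its ℍ-spectrum is attained
at a complex point of it. -/
theorem exists_coeComplex_mem_qSpectrum {x : A} (hx : ∀ z : ℍ, x * φ z = φ z * x) {z : ℍ}
    (hz : z ∈ qSpectrum φ x) : ∃ c : ℂ, (c : ℍ) ∈ qSpectrum φ x ∧ ‖c‖ = ‖z‖ := by
  obtain ⟨u, c, hu, huz⟩ := Quaternion.exists_mul_eq_coeComplex_mul z
  refine ⟨c, fun hc => hz ?_, ?_⟩
  · have hU : IsUnit (φ u) := (isUnit_iff_ne_zero.2 hu).map φ
    have key : φ u * (φ z - x) = (φ c - x) * φ u := by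
      rw [mul_sub, sub_mul, ← map_mul, ← map_mul, huz, hx]
    obtain ⟨v, hv⟩ := hU
    rw [← Units.isUnit_units_mul v, hv, key]
    exact hc.mul ⟨v, hv⟩
  · have := congrArg norm huz
    rw [norm_mul, norm_mul, Quaternion.norm_coeComplex, mul_comm] at this
    exact (mul_right_cancel₀ (norm_ne_zero_iff.2 hu) this).symm

theorem qSpectralRadius_nonneg (x : A) : 0 ≤ qSpectralRadius φ x :=
  Real.sSup_nonneg (by rintro _ ⟨z, -, rfl⟩; exact norm_nonneg z)

variable [CompleteSpace A]

theorem norm_le_of_mem_qSpectrum (hφ : ∀ z : ℍ, ‖φ z‖ = ‖z‖) {x : A} {z : ℍ}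
    (hz : z ∈ qSpectrum φ x) : ‖z‖ ≤ ‖x‖ := by
  by_contra! h
  have hz0 : z ≠ 0 := norm_pos_iff.1 ((norm_nonneg x).trans_lt h)
  refine hz (Units.ofNearby (Units.map (φ : ℍ →* A) (Units.mk0 z hz0)) (φ z - x) ?_).isUnit
  rw [← map_inv]
  simpa [hφ] using h

theorem norm_le_qSpectralRadius (hφ : ∀ z : ℍ, ‖φ z‖ = ‖z‖) {x : A} {z : ℍ}
    (hz : z ∈ qSpectrum φ x) : ‖z‖ ≤ qSpectralRadius φ x :=
  le_csSup ⟨‖x‖, by rintro _ ⟨w, hw, rfl⟩; exact norm_le_of_mem_qSpectrum φ hφ hw⟩ ⟨z, hz, rfl⟩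

/-- Joint spectral mapping: on the bicommutant of `a`, `b` and the complex scalars, characters
realise the spectra simultaneously. -/
theorem exists_subring_ringHom_mem_qSpectrum (hφ : ∀ z : ℍ, ‖φ z‖ = ‖z‖) {a b : A}
    (hab : a * b = b * a)
    (ha : ∀ z : ℍ, a * φ z = φ z * a) (hb : ∀ z : ℍ, b * φ z = φ z * b) :
    ∃ (D : Subring A), a ∈ D ∧ b ∈ D ∧ ∀ (x : D) (c : ℂ), (c : ℍ) ∈ qSpectrum φ (x : A) →
      ∃ f : D →+* ℂ, f x = c ∧ ∀ y : D, (f y : ℍ) ∈ qSpectrum φ (y : A) := by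
  have hc : ∀ c d : ℂ, φ c * φ d = φ d * φ c := fun c d => by
    rw [← map_mul, ← map_mul, ← Quaternion.coeComplex_mul, mul_comm, Quaternion.coeComplex_mul]
  obtain ⟨D, hSD, hcl, hcomm, hinv⟩ := exists_closed_comm_subring_of_comm
    ({a, b} ∪ Set.range fun c : ℂ => φ c) (by
      rintro x ((rfl | rfl) | ⟨c, rfl⟩) y ((rfl | rfl) | ⟨d, rfl⟩) <;> simp [*])
  let ι : ℂ →+* D := ((φ.comp Quaternion.ofComplex : ℂ →ₐ[ℝ] A) : ℂ →+* A).codRestrict D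
    fun c => hSD (Or.inr ⟨c, rfl⟩)
  refine ⟨D, hSD (by simp), hSD (by simp), fun x c hx => ?_⟩
  exact D.exists_ringHom_complex_of_not_isUnit hcl hcomm hinv ι
    (fun c => ((hφ c).trans (Quaternion.norm_coeComplex c)).le) c x hx

end

/-- For commuting elements `a`, `b` of a Banach algebra over ℍ, each commuting with
all quaternion scalars, `r(a·b) ≤ r(a)·r(b)` and `r(a+b) ≤ r(a) + r(b)`. -/
theorem stmt_10 {A : Type*} [NormedRing A] [NormedAlgebra ℝ A] [CompleteSpace A]
    [NormOneClass A]
    (φ : ℍ →ₐ[ℝ] A) (hφ : ∀ z : ℍ, ‖φ z‖ = ‖z‖)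
    (a b : A) (hab : a * b = b * a)
    (ha : ∀ z : ℍ, a * φ z = φ z * a) (hb : ∀ z : ℍ, b * φ z = φ z * b) :
    qSpectralRadius φ (a * b) ≤ qSpectralRadius φ a * qSpectralRadius φ b ∧
    qSpectralRadius φ (a + b) ≤ qSpectralRadius φ a + qSpectralRadius φ b := by
  obtain ⟨D, haD, hbD, hD⟩ := exists_subring_ringHom_mem_qSpectrum φ hφ hab ha hb
  lift a to D using haD
  lift b to D using hbD
  have hra := qSpectralRadius_nonneg φ (a : A)
  have hrb := qSpectralRadius_nonneg φ (b : A)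
  have bound : ∀ (f : D →+* ℂ), (∀ y : D, (f y : ℍ) ∈ qSpectrum φ (y : A)) →
      ∀ y : D, ‖f y‖ ≤ qSpectralRadius φ (y : A) := fun f hf y => by
    rw [← Quaternion.norm_coeComplex]
    exact norm_le_qSpectralRadius φ hφ (hf y)
  constructor
  · refine Real.sSup_le ?_ (by positivity)
    rintro _ ⟨z, hz, rfl⟩
    obtain ⟨c, hc, hcz⟩ := exists_coeComplex_mem_qSpectrum φ
      (fun z => by rw [mul_assoc, hb, ← mul_assoc, ha, mul_assoc]) hz
    obtain ⟨f, hfc, hf⟩ := hD (a * b) c hc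
    rw [← hcz, ← hfc, map_mul, norm_mul]
    exact mul_le_mul (bound f hf a) (bound f hf b) (norm_nonneg _) hra
  · refine Real.sSup_le ?_ (by positivity)
    rintro _ ⟨z, hz, rfl⟩
    obtain ⟨c, hc, hcz⟩ := exists_coeComplex_mem_qSpectrum φ
      (fun z => by rw [add_mul, mul_add, ha, hb]) hz
    obtain ⟨f, hfc, hf⟩ := hD (a + b) c hc
    rw [← hcz, ← hfc, map_add]
    exact (norm_add_le _ _).trans (add_le_add (bound f hf a) (bound f hf b))
end

section
/- Let 𝒜 be a C*-algebra over ℍ satisfying the quasicommutativity hypothesis, with scalar embedding φ, let A ∈ 𝒜 be selfadjoint, and let b be a real number with b ≥ ‖A‖. Then every element of σ(A) is a nonnegative real quaternion (σ(A) ⊆ [0, ∞)) if and only if ‖A − φ(b)‖ ≤ b. -/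
local notation "ℍ" => Quaternion ℝ

/-- The commutant of an isometric star-preserving copy of `ℂ` in a real C*-algebra is a complex
C*-algebra, closed under inverses. -/
theorem exists_cstarAlgebra_commutant.{u} {A : Type u} [NormedRing A] [CompleteSpace A] [StarRing A]
    (hCstar : ∀ x : A, ‖star x * x‖ = ‖x‖ ^ 2) (ψ : ℂ →+* A) (hψ : ∀ z, ‖ψ z‖ = ‖z‖)
    (hψstar : ∀ z, ψ (star z) = star (ψ z)) :
    ∃ (B : Type u) (_ : CStarAlgebra B) (f : B →+* A), (∀ x, ‖f x‖ = ‖x‖) ∧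
      (∀ x, f (star x) = star (f x)) ∧ (∀ z, f (algebraMap ℂ B z) = ψ z) ∧
      (∀ x, IsUnit (f x) → IsUnit x) ∧ ∀ y, (∀ z, Commute y (ψ z)) → ∃ x, f x = y := by
  let S := Subring.centralizer (Set.range ψ)
  have mem_S (y : A) : y ∈ S ↔ ∀ z, Commute y (ψ z) := by
    simp [S, Subring.mem_centralizer_iff, commute_iff_eq, eq_comm]
  have star_mem (y : A) (hy : y ∈ S) : star y ∈ S := by
    rw [mem_S] at hy ⊢
    intro z
    have := (hy (star z)).star_star
    rwa [← hψstar, star_star] at this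
  let _ : StarRing S :=
    { star := fun x ↦ ⟨star x.1, star_mem x.1 x.2⟩
      star_involutive := fun x ↦ Subtype.ext (star_star x.1)
      star_mul := fun x y ↦ Subtype.ext (star_mul x.1 y.1)
      star_add := fun x y ↦ Subtype.ext (star_add x.1 y.1) }
  have coe_star (x : S) : ((star x : S) : A) = star (x : A) := rfl
  let j : ℂ →+* S := ψ.codRestrict S fun z ↦
    (mem_S _).2 fun w ↦ by rw [commute_iff_eq, ← map_mul, ← map_mul, mul_comm]
  let _ : Algebra ℂ S := j.toAlgebra' fun z x ↦ Subtype.ext (((mem_S _).1 x.2 z).eq).symm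
  have smul_def (z : ℂ) (x : S) : ((z • x : S) : A) = ψ z * x := rfl
  have hclosed : IsClosed (S : Set A) := Set.isClosed_centralizer _
  let inst : CStarAlgebra S :=
    { (inferInstance : NormedRing S), (inferInstance : StarRing S),
      (inferInstance : Algebra ℂ S) with
      complete := hclosed.completeSpace_coe.complete
      norm_mul_self_le := fun x ↦ by
        change ‖(x : A)‖ * ‖(x : A)‖ ≤ ‖star (x : A) * x‖
        rw [hCstar, sq]
      norm_smul_le := fun z x ↦ by
        change ‖ψ z * x‖ ≤ ‖z‖ * ‖(x : A)‖
        exact (norm_mul_le _ _).trans_eq (by rw [hψ])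
      star_smul := fun z x ↦ Subtype.ext <| by
        rw [smul_def, coe_star, coe_star, smul_def, star_mul, hψstar]
        have := (mem_S _).1 (star_mem x x.2) (star z)
        rw [hψstar] at this
        exact this }
  refine ⟨S, inst, S.subtype, fun _ ↦ rfl, fun _ ↦ rfl, fun _ ↦ rfl, fun x hx ↦ ?_,
    fun y hy ↦ ⟨⟨y, (mem_S y).2 hy⟩, rfl⟩⟩
  obtain ⟨u, hu⟩ := hx
  have hu' : (u : A) = x := hu
  have hinv : ((u⁻¹ : Aˣ) : A) ∈ S := (mem_S _).2 fun z ↦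
    Commute.units_inv_left (by rw [hu']; exact (mem_S _).1 x.2 z)
  refine ⟨⟨x, ⟨_, hinv⟩, Subtype.ext ?_, Subtype.ext ?_⟩, rfl⟩
  · change (x : A) * ((u⁻¹ : Aˣ) : A) = 1
    rw [← hu', Units.mul_inv]
  · change ((u⁻¹ : Aˣ) : A) * (x : A) = 1
    rw [← hu', Units.inv_mul]

theorem spectrum_nonneg_iff_norm_sub_le {B : Type*} [CStarAlgebra B] {x : B}
    (hx : IsSelfAdjoint x) {b : ℝ} (hb : ‖x‖ ≤ b) :
    (∀ r ∈ spectrum ℝ x, 0 ≤ r) ↔ ‖x - algebraMap ℂ B b‖ ≤ b := by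
  lift b to NNReal using (norm_nonneg x).trans hb
  rw [← SpectrumRestricts.nnreal_iff, SpectrumRestricts.nnreal_iff_nnnorm hx (by exact_mod_cast hb),
    norm_sub_rev]
  exact NNReal.coe_le_coe.symm

theorem star_coeComplex (z : ℂ) : star (z : ℍ) = ((star z : ℂ) : ℍ) := by
  ext <;> simp

theorem normSq_coeComplex (z : ℂ) : Quaternion.normSq (z : ℍ) = Complex.normSq z := by
  simp [Quaternion.normSq_def', Complex.normSq_apply, sq]

/-- The square of the norm of a quaternion splits into real and imaginary parts. -/
theorem normSq_eq_re_sq_add_norm_im_sq (z : ℍ) :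
    Quaternion.normSq z = z.re ^ 2 + ‖z.im‖ ^ 2 := by
  rw [sq ‖z.im‖, ← Quaternion.normSq_eq_norm_mul_self, Quaternion.normSq_def',
    Quaternion.normSq_def']
  simp
  ring

/-- Quaternions with the same real part and norm give the same real quadratic polynomial. -/
theorem sub_mul_star_sub_eq {A : Type*} [Ring A] (φ : ℍ →+* A) {a : A}
    (ha : ∀ z, Commute a (φ z)) {z w : ℍ} (hre : z.re = w.re)
    (hnorm : Quaternion.normSq z = Quaternion.normSq w) :
    (φ z - a) * (φ (star z) - a) = (φ w - a) * (φ (star w) - a) := by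
  have expand (q : ℍ) : (φ q - a) * (φ (star q) - a) =
      φ (Quaternion.normSq q : ℝ) - a * φ (2 * (q.re : ℍ)) + a * a := by
    rw [← Quaternion.self_mul_star, ← Quaternion.self_add_star, map_mul, map_add,
      sub_mul, mul_sub, mul_sub, mul_add, (ha q).eq]
    abel
  rw [expand, expand, hre, hnorm]

/-- A selfadjoint element shifted by a nonreal complex number is invertible. -/
theorem IsSelfAdjoint.isUnit_algebraMap_sub {B : Type*} [CStarAlgebra B] {x : B}
    (hx : IsSelfAdjoint x) {w : ℂ} (hw : w.im ≠ 0) : IsUnit (algebraMap ℂ B w - x) :=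
  spectrum.notMem_iff.1 fun h ↦ hw (hx.im_eq_zero_of_mem_spectrum h)

/-- In a C*-algebra over ℍ satisfying the quasicommutativity hypothesis, a
selfadjoint element `a` has spectrum contained in `[0, ∞)` iff `‖a − φ(b)‖ ≤ b`
for any real `b ≥ ‖a‖`. -/
theorem stmt_12 {A : Type*} [NormedRing A] [NormedAlgebra ℝ A] [CompleteSpace A]
    [NormOneClass A] [StarRing A]
    (φ : ℍ →ₐ[ℝ] A) (hφ : ∀ z : ℍ, ‖φ z‖ = ‖z‖)
    (hCstar : ∀ x : A, ‖star x * x‖ = ‖x‖ ^ 2)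
    (hφstar : ∀ z : ℍ, φ (star z) = star (φ z))
    (hquasi : ∀ x : A, star x = x → ∀ a : ℍ, x * φ a = φ a * x)
    (a : A) (hsa : star a = a) (b : ℝ) (hb : ‖a‖ ≤ b) :
    (∀ z ∈ qSpectrum φ a, ∃ r : ℝ, 0 ≤ r ∧ z = algebraMap ℝ ℍ r) ↔
      ‖a - φ (algebraMap ℝ ℍ b)‖ ≤ b := by
  have hcomm (z : ℍ) : Commute a (φ z) := hquasi a hsa z
  obtain ⟨B, _, f, hnorm, hstar, halg, hunit, hsurj⟩ := exists_cstarAlgebra_commutant hCstar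
    ((φ : ℍ →+* A).comp (Quaternion.ofComplex : ℂ →+* ℍ))
    (fun z ↦ by simp [hφ, norm_coeComplex]) (fun z ↦ by simp [← hφstar, star_coeComplex])
  have halg' (z : ℂ) : f (algebraMap ℂ B z) = φ z := halg z
  obtain ⟨x, rfl⟩ := hsurj a fun z ↦ hcomm z
  have hinj : Function.Injective f := (injective_iff_map_eq_zero f).2 fun y hy ↦ by
    rw [← norm_eq_zero, ← hnorm, hy, norm_zero]
  have hx : IsSelfAdjoint x := hinj (by rw [hstar, hsa])
  have hreal (r : ℝ) : algebraMap ℝ ℍ r ∈ qSpectrum φ (f x) ↔ r ∈ spectrum ℝ x := by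
    have h : φ (algebraMap ℝ ℍ r) - f x = f (algebraMap ℝ B r - x) := by
      rw [IsScalarTower.algebraMap_apply ℝ ℂ B, map_sub, halg']
      simp
    rw [qSpectrum, Set.mem_ofPred_eq, h, spectrum.mem_iff]
    exact not_congr ⟨hunit _, fun h ↦ h.map f⟩
  have hbnorm : ‖f x - φ (algebraMap ℝ ℍ b)‖ = ‖x - algebraMap ℂ B b‖ := by
    rw [← hnorm, map_sub, halg']
    simp
  rw [hbnorm, ← spectrum_nonneg_iff_norm_sub_le hx (hnorm x ▸ hb)]
  constructor
  · intro h r hr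
    obtain ⟨s, hs, hrs⟩ := h _ ((hreal r).2 hr)
    rwa [(algebraMap ℝ ℍ).injective hrs]
  · intro h z hz
    obtain ⟨r, rfl⟩ : ∃ r : ℝ, z = algebraMap ℝ ℍ r := by
      by_contra! hne
      apply hz
      let w : ℂ := ⟨z.re, ‖z.im‖⟩
      have hw : w.im ≠ 0 := fun h0 ↦ hne z.re <| by
        rw [← Quaternion.re_add_im z, norm_eq_zero.1 h0]
        simp
      have hprod : (φ z - f x) * (φ (star z) - f x) =
          f ((algebraMap ℂ B w - x) * (algebraMap ℂ B (star w) - x)) := by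
        rw [map_mul, map_sub, map_sub, halg', halg', ← star_coeComplex]
        refine sub_mul_star_sub_eq (φ : ℍ →+* A) hcomm rfl ?_
        rw [normSq_coeComplex, normSq_eq_re_sq_add_norm_im_sq, Complex.normSq_apply, sq, sq]
      have hcomm' : Commute (φ z - f x) (φ (star z) - f x) := by
        have hz : Commute (φ z) (φ (star z)) := by
          rw [commute_iff_eq, ← map_mul, ← map_mul, Quaternion.self_mul_star,
            Quaternion.star_mul_self]
        exact (hz.sub_left (hcomm _)).sub_right ((hcomm z).symm.sub_left (Commute.refl _))
      refine (hcomm'.isUnit_mul_iff.1 ?_).1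
      rw [hprod]
      exact ((hx.isUnit_algebraMap_sub hw).mul
        (hx.isUnit_algebraMap_sub (by simpa using hw))).map f
    exact ⟨r, h r ((hreal r).1 hz), rfl⟩
end

section
/- Let 𝒜 be a C*-algebra over ℍ satisfying the quasicommutativity hypothesis, with scalar embedding φ. Let M ⊆ 𝒜 be an additive subgroup containing 1, closed under the involution and under x ↦ φ(a)·x and x ↦ x·φ(a) for all a ∈ ℍ. Let ρ : M → ℍ be additive and either left ℍ-linear (ρ(φ(a)·x) = a·ρ(x) for all a ∈ ℍ, x ∈ M) or right ℍ-linear (ρ(x·φ(a)) = ρ(x)·a for all a ∈ ℍ, x ∈ M). Call ρ nonnegative if ρ(A) is a nonnegative real quaternion for every selfadjoint A ∈ M with σ(A) ⊆ [0, ∞). Then ρ is nonnegative if and only if ρ is bounded with ‖ρ‖ = ρ(1), where ‖ρ‖ = sup{‖ρ(x)‖ : x ∈ M, ‖x‖ ≤ 1}. -/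
local notation "ℍ" => Quaternion ℝ

section CommutantOfComplex

variable {A : Type*} [NormedRing A] [StarRing A]

/-- The commutant of a `⋆`-preserving isometric copy of `ℂ` in a real C⋆-algebra is a complex
C⋆-algebra. -/
noncomputable abbrev commutantCStarAlgebra [CompleteSpace A] (ψ : ℂ →+* A)
    (hψ : ∀ z, ‖ψ z‖ = ‖z‖) (hψstar : ∀ z, ψ (star z) = star (ψ z))
    (hCstar : ∀ x : A, ‖star x * x‖ = ‖x‖ ^ 2) :
    CStarAlgebra (Subring.centralizer (Set.range ψ)) :=
  { SubringClass.toNormedRing (Subring.centralizer (Set.range ψ)) with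
    star := fun x => ⟨star (x : A), by
      rintro _ ⟨z, rfl⟩
      have h := x.2 (ψ (star z)) ⟨_, rfl⟩
      have h' := congrArg star h
      rw [star_mul, star_mul, ← hψstar, star_star] at h'
      exact h'.symm⟩
    star_involutive := fun x => Subtype.ext (star_star (x : A))
    star_mul := fun x y => Subtype.ext (star_mul (x : A) y)
    star_add := fun x y => Subtype.ext (star_add (x : A) y)
    complete := (Set.isClosed_centralizer (Set.range ψ)).completeSpace_coe.complete
    norm_mul_self_le := fun x => by
      have h := hCstar (x : A)
      rw [sq] at h
      exact h.ge
    smul := fun z x => ⟨ψ z * x, by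
      rintro _ ⟨w, rfl⟩
      rw [← mul_assoc, ← map_mul, mul_comm w z, map_mul, mul_assoc, x.2 (ψ w) ⟨_, rfl⟩,
        mul_assoc]⟩
    algebraMap := ψ.codRestrict _ fun z => by
      rintro _ ⟨w, rfl⟩
      rw [← map_mul, mul_comm, map_mul]
    commutes' := fun z x => Subtype.ext (x.2 (ψ z) ⟨_, rfl⟩)
    smul_def' := fun z x => rfl
    norm_smul_le := fun z x => by
      have h := norm_mul_le (ψ z) (x : A)
      rw [hψ] at h
      exact h
    star_smul := fun z x => Subtype.ext <| by
      change star (ψ z * (x : A)) = ψ (star z) * star (x : A)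
      have hx : star (x : A) * ψ (star z) = ψ (star z) * star (x : A) := by
        have h := congrArg star (x.2 (ψ z) ⟨_, rfl⟩)
        rwa [star_mul, star_mul, ← hψstar] at h
      rw [star_mul, ← hψstar, hx] }

variable [CompleteSpace A] {ψ : ℂ →+* A} (hψ : ∀ z, ‖ψ z‖ = ‖z‖)
  (hψstar : ∀ z, ψ (star z) = star (ψ z)) (hCstar : ∀ x : A, ‖star x * x‖ = ‖x‖ ^ 2)
  {b : A} (hb : star b = b) (hbψ : ∀ z, ψ z * b = b * ψ z)

theorem isUnit_centralizer_iff {R : Type*} [Ring R] {s : Set R} (x : Subring.centralizer s) :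
    IsUnit x ↔ IsUnit (x : R) := by
  refine ⟨fun h => h.map (Subring.centralizer s).subtype, ?_⟩
  rintro ⟨u, hu⟩
  have hinv : (↑u⁻¹ : R) ∈ Subring.centralizer s := fun g hg => by
    have h : Commute g (u : R) := hu ▸ x.2 g hg
    exact h.units_inv_right
  refine ⟨⟨x, ⟨_, hinv⟩, Subtype.ext ?_, Subtype.ext ?_⟩, rfl⟩ <;> simp [← hu]

include hψ hψstar hCstar hb hbψ

theorem isUnit_sub_of_im_ne_zero {z : ℂ} (hz : z.im ≠ 0) : IsUnit (ψ z - b) := by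
  let _ := commutantCStarAlgebra ψ hψ hψstar hCstar
  let b' : Subring.centralizer (Set.range ψ) := ⟨b, by rintro _ ⟨z, rfl⟩; exact hbψ z⟩
  have hb' : IsSelfAdjoint b' := Subtype.ext hb
  by_contra h
  have hmem : z ∈ spectrum ℂ b' := fun hu => h ((isUnit_centralizer_iff _).1 hu)
  exact hz (hb'.im_eq_zero_of_mem_spectrum hmem)

theorem isUnit_sub_of_norm_lt_s13 {z : ℂ} (hz : ‖b‖ < ‖z‖) : IsUnit (ψ z - b) := by
  let _ := commutantCStarAlgebra ψ hψ hψstar hCstar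
  let b' : Subring.centralizer (Set.range ψ) := ⟨b, by rintro _ ⟨z, rfl⟩; exact hbψ z⟩
  have hb' : IsSelfAdjoint b' := Subtype.ext hb
  by_contra h
  have hmem : z ∈ spectrum ℂ b' := fun hu => h ((isUnit_centralizer_iff _).1 hu)
  have hle : (‖z‖₊ : ENNReal) ≤ ‖b'‖₊ := by
    rw [← hb'.spectralRadius_eq_nnnorm]
    exact le_iSup₂ (f := fun (k : ℂ) (_ : k ∈ spectrum ℂ b') => (‖k‖₊ : ENNReal)) z hmem
  have hle' : ‖z‖ ≤ ‖b‖ := by exact_mod_cast hle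
  exact hz.not_ge hle'

theorem norm_le_of_forall_not_isUnit {r : NNReal}
    (hr : ∀ z : ℂ, ¬ IsUnit (ψ z - b) → ‖z‖ ≤ r) : ‖b‖ ≤ r := by
  let _ := commutantCStarAlgebra ψ hψ hψstar hCstar
  let b' : Subring.centralizer (Set.range ψ) := ⟨b, by rintro _ ⟨z, rfl⟩; exact hbψ z⟩
  have hb' : IsSelfAdjoint b' := Subtype.ext hb
  have hle : (‖b'‖₊ : ENNReal) ≤ r := by
    rw [← hb'.spectralRadius_eq_nnnorm]
    refine iSup₂_le fun z hz => ?_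
    have h := hr z fun hu => hz ((isUnit_centralizer_iff _).2 hu)
    exact_mod_cast h
  exact_mod_cast hle

end CommutantOfComplex

section QuaternionScalars

variable {A : Type*} [NormedRing A] [NormedAlgebra ℝ A] {φ : ℍ →ₐ[ℝ] A}

theorem mul_star_sub_of_commute {y : A} (hy : ∀ a, y * φ a = φ a * y) (p : ℍ) :
    (φ p - y) * (φ (star p) - y) =
      algebraMap ℝ A (Quaternion.normSq p) - (2 * p.re) • y + y * y := by
  have h1 : φ p * φ (star p) = algebraMap ℝ A (Quaternion.normSq p) := by
    rw [← map_mul, Quaternion.self_mul_star, ← Quaternion.algebraMap_def, AlgHom.commutes]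
  have h2 : φ p + φ (star p) = algebraMap ℝ A (2 * p.re) := by
    rw [← map_add, Quaternion.self_add_star', ← Quaternion.algebraMap_def, AlgHom.commutes]
  rw [Algebra.smul_def, ← h2, ← h1, sub_mul, mul_sub, mul_sub, add_mul, hy]
  abel

/-- The copy of `ℂ` inside `A` spanned by `1` and `φ i`. -/
noncomputable def complexScalars (φ : ℍ →ₐ[ℝ] A) : ℂ →+* A :=
  (φ : ℍ →+* A).comp (Quaternion.ofComplex : ℂ →+* ℍ)

theorem complexScalars_apply (z : ℂ) : complexScalars φ z = φ (z : ℍ) := rfl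

theorem complexScalars_ofReal (r : ℝ) : complexScalars φ r = algebraMap ℝ A r := by
  rw [complexScalars_apply, Quaternion.coeComplex_coe, ← Quaternion.algebraMap_def,
    AlgHom.commutes]

theorem norm_complexScalars (hφ : ∀ z : ℍ, ‖φ z‖ = ‖z‖) (z : ℂ) :
    ‖complexScalars φ z‖ = ‖z‖ := by
  rw [complexScalars_apply, hφ, ← sq_eq_sq₀ (norm_nonneg _) (norm_nonneg _), sq,
    ← Quaternion.normSq_eq_norm_mul_self, Quaternion.normSq_def', Complex.sq_norm,
    Complex.normSq_apply]
  simp [sq]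

variable [StarRing A]

theorem complexScalars_star (hφstar : ∀ z : ℍ, φ (star z) = star (φ z)) (z : ℂ) :
    complexScalars φ (star z) = star (complexScalars φ z) := by
  rw [complexScalars_apply, complexScalars_apply, ← hφstar]
  congr 1
  ext <;> simp

theorem star_algebraMap_real (hφstar : ∀ z : ℍ, φ (star z) = star (φ z)) (r : ℝ) :
    star (algebraMap ℝ A r) = algebraMap ℝ A r := by
  rw [← AlgHom.commutes φ, ← hφstar, Quaternion.algebraMap_def, Quaternion.star_coe]

variable [CompleteSpace A] (hφ : ∀ z : ℍ, ‖φ z‖ = ‖z‖)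
    (hCstar : ∀ x : A, ‖star x * x‖ = ‖x‖ ^ 2)
    (hφstar : ∀ z : ℍ, φ (star z) = star (φ z))

include hφ hCstar hφstar

theorem isUnit_sub_of_re_ne {y : A} (hy : star y = y) (hyφ : ∀ a, y * φ a = φ a * y) {z : ℍ}
    (hz : z ≠ algebraMap ℝ ℍ z.re) : IsUnit (φ z - y) := by
  set s : ℝ := z.imI ^ 2 + z.imJ ^ 2 + z.imK ^ 2 with hs
  have hs0 : 0 < s := by
    by_contra h
    have hI : z.imI = 0 := by nlinarith [sq_nonneg z.imI, sq_nonneg z.imJ, sq_nonneg z.imK]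
    have hJ : z.imJ = 0 := by nlinarith [sq_nonneg z.imI, sq_nonneg z.imJ, sq_nonneg z.imK]
    have hK : z.imK = 0 := by nlinarith [sq_nonneg z.imI, sq_nonneg z.imJ, sq_nonneg z.imK]
    exact hz (by rw [Quaternion.algebraMap_def]; ext <;> simp [hI, hJ, hK])
  have hsqrt : Real.sqrt s ≠ 0 := (Real.sqrt_pos.2 hs0).ne'
  have hunit (w : ℂ) (hw : w.im ≠ 0) : IsUnit (φ (w : ℍ) - y) :=
    isUnit_sub_of_im_ne_zero (norm_complexScalars hφ) (complexScalars_star hφstar) hCstar hy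
      (fun z => (hyφ z).symm) hw
  let w : ℂ := ⟨z.re, Real.sqrt s⟩
  have hw := (hunit w hsqrt).mul (hunit (star w) (by simpa [w] using hsqrt))
  have hwstar : ((star w : ℂ) : ℍ) = star (w : ℍ) := by ext <;> simp
  have hnorm : Quaternion.normSq (w : ℍ) = Quaternion.normSq z := by
    simp [Quaternion.normSq_def', w, Real.sq_sqrt hs0.le]
    rw [hs]
    ring
  have hre : (w : ℍ).re = z.re := by simp [w]
  rw [hwstar, mul_star_sub_of_commute hyφ, hnorm, hre, ← mul_star_sub_of_commute hyφ] at hw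
  have hcomm : Commute (φ z - y) (φ (star z) - y) := by
    have h1 : Commute (φ z) (φ (star z)) := by
      rw [Commute, SemiconjBy, ← map_mul, ← map_mul, Quaternion.self_mul_star,
        Quaternion.star_mul_self]
    exact (h1.sub_right (hyφ z).symm).sub_left
      ((show Commute y (φ (star z)) from hyφ _).sub_right (Commute.refl y))
  exact (hcomm.isUnit_mul_iff.1 hw).1

theorem nonneg_of_mem_qSpectrum_algebraMap_sub {b : A} (hb : star b = b)
    (hbφ : ∀ a, b * φ a = φ a * b) {t : ℝ} (ht : ‖b‖ ≤ t) {z : ℍ}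
    (hz : z ∈ qSpectrum φ (algebraMap ℝ A t - b)) : ∃ r : ℝ, 0 ≤ r ∧ z = algebraMap ℝ ℍ r := by
  have hzre : z = algebraMap ℝ ℍ z.re := by
    by_contra h
    refine hz (isUnit_sub_of_re_ne hφ hCstar hφstar ?_ (fun a => ?_) h)
    · rw [star_sub, hb, star_algebraMap_real hφstar]
    · rw [sub_mul, mul_sub, hbφ, Algebra.commutes]
  refine ⟨z.re, ?_, hzre⟩
  by_contra! hneg
  have hlt : ‖b‖ < ‖((t - z.re : ℝ) : ℂ)‖ := by
    rw [Complex.norm_real]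
    exact lt_of_lt_of_le (by linarith) (le_abs_self _)
  have hu := isUnit_sub_of_norm_lt_s13 (norm_complexScalars hφ) (complexScalars_star hφstar) hCstar
    hb (fun z => (hbφ z).symm) hlt
  rw [complexScalars_ofReal, map_sub] at hu
  refine hz ?_
  rw [hzre, AlgHom.commutes]
  convert hu.neg using 1
  abel

theorem norm_algebraMap_norm_sub_le {b : A} (hb : star b = b)
    (hbφ : ∀ a, b * φ a = φ a * b)
    (hspec : ∀ z ∈ qSpectrum φ b, ∃ r : ℝ, 0 ≤ r ∧ z = algebraMap ℝ ℍ r) :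
    ‖algebraMap ℝ A ‖b‖ - b‖ ≤ ‖b‖ := by
  refine norm_le_of_forall_not_isUnit (r := ‖b‖₊) (norm_complexScalars hφ)
    (complexScalars_star hφstar) hCstar ?_ (fun z => ?_) fun z hz => ?_
  · rw [star_sub, hb, star_algebraMap_real hφstar]
  · rw [complexScalars_apply, sub_mul, mul_sub, hbφ, Algebra.commutes]
  have hz' : ¬ IsUnit (complexScalars φ (‖b‖ - z) - b) := by
    refine fun hu => hz ?_
    rw [map_sub, complexScalars_ofReal] at hu
    convert hu.neg using 1
    abel
  obtain ⟨r, hr0, hr⟩ := hspec _ hz'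
  have hle : ‖(‖b‖ - z : ℂ)‖ ≤ ‖b‖ := by
    by_contra! h
    exact hz' (isUnit_sub_of_norm_lt_s13 (norm_complexScalars hφ) (complexScalars_star hφstar) hCstar
      hb (fun z => (hbφ z).symm) h)
  have hzr : z = ((‖b‖ - r : ℝ) : ℂ) := by
    have h1 := congrArg QuaternionAlgebra.re hr
    have h2 := congrArg QuaternionAlgebra.imI hr
    rw [Quaternion.algebraMap_def] at h1 h2
    apply Complex.ext
    · simp at h1 ⊢
      linarith
    · simpa using h2
  have hsub : (‖b‖ - z : ℂ) = (r : ℂ) := by rw [hzr]; push_cast; ring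
  rw [hsub, Complex.norm_real, Real.norm_of_nonneg hr0] at hle
  rw [hzr, Complex.norm_real, coe_nnnorm, Real.norm_eq_abs, abs_le]
  constructor <;> linarith [norm_nonneg b]

end QuaternionScalars

section QuaternionDecomposition

/-- The quaternion unit `i`. -/
@[simps]
noncomputable def qI : ℍ := ⟨0, 1, 0, 0⟩

/-- The quaternion unit `j`. -/
@[simps]
noncomputable def qJ : ℍ := ⟨0, 0, 1, 0⟩

/-- The quaternion unit `k`. -/
@[simps]
noncomputable def qK : ℍ := ⟨0, 0, 0, 1⟩

theorem star_quaternion_units : star qI = -qI ∧ star qJ = -qJ ∧ star qK = -qK := by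
  refine ⟨?_, ?_, ?_⟩ <;> ext <;> simp

theorem quaternion_units_mul :
    qI * qI = -1 ∧ qJ * qJ = -1 ∧ qK * qK = -1 ∧ qI * qJ = qK ∧ qJ * qI = -qK ∧
      qJ * qK = qI ∧ qK * qJ = -qI ∧ qK * qI = qJ ∧ qI * qK = -qJ := by
  refine ⟨?_, ?_, ?_, ?_, ?_, ?_, ?_, ?_, ?_⟩ <;> ext <;> simp <;> rfl

variable {A : Type*} [Ring A] [Algebra ℝ A] (φ : ℍ →ₐ[ℝ] A)

/-- Four times the projection of `A` onto the commutant of the quaternion scalars. -/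
noncomputable def fourRe (x : A) : A :=
  x - φ qI * (x * φ qI) - φ qJ * (x * φ qJ) - φ qK * (x * φ qK)

theorem fourRe_decomposition (x : A) :
    fourRe φ x - φ qI * fourRe φ (φ qI * x) - φ qJ * fourRe φ (φ qJ * x) -
      φ qK * fourRe φ (φ qK * x) = (4 : ℕ) • x := by
  obtain ⟨h1, h2, h3, h4, h5, h6, h7, h8, h9⟩ := quaternion_units_mul
  have e {p q r : ℍ} (h : p * q = r) (y : A) : φ p * (φ q * y) = φ r * y := by
    rw [← mul_assoc, ← map_mul, h]
  simp only [fourRe, mul_sub, mul_assoc, e h1, e h2, e h3, e h4, e h5, e h6, e h7, e h8, e h9,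
    map_neg, map_one, neg_mul, one_mul, mul_neg]
  abel

theorem fourRe_commute (x : A) :
    fourRe φ x * φ qI = φ qI * fourRe φ x ∧ fourRe φ x * φ qJ = φ qJ * fourRe φ x := by
  obtain ⟨h1, h2, h3, h4, h5, h6, h7, h8, h9⟩ := quaternion_units_mul
  have e {p q r : ℍ} (h : p * q = r) (y : A) : φ p * (φ q * y) = φ r * y := by
    rw [← mul_assoc, ← map_mul, h]
  have e' {p q r : ℍ} (h : p * q = r) : φ p * φ q = φ r := by rw [← map_mul, h]
  constructor <;>
  · simp only [fourRe, mul_sub, sub_mul, mul_assoc, e h1, e h2, e h4, e h5, e h6, e h9, e' h1,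
      e' h2, e' h4, e' h5, e' h7, e' h8, map_neg, map_one, neg_mul, one_mul, mul_neg, mul_one]
    abel

variable {φ}

theorem star_eq_of_commute_units [StarRing A] (hφstar : ∀ z : ℍ, φ (star z) = star (φ z))
    (hquasi : ∀ x : A, star x = x → ∀ a : ℍ, x * φ a = φ a * x) {y : A}
    (hI : y * φ qI = φ qI * y) (hJ : y * φ qJ = φ qJ * y) : star y = y := by
  obtain ⟨-, -, h3, h4, h5, -⟩ := quaternion_units_mul
  obtain ⟨hsI, hsJ, -⟩ := star_quaternion_units
  have hstarI : star (φ qI) = -φ qI := by rw [← hφstar, hsI, map_neg]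
  have hstarJ : star (φ qJ) = -φ qJ := by rw [← hφstar, hsJ, map_neg]
  have hI' : star y * φ qI = φ qI * star y := by
    have h := congrArg star hI
    rw [star_mul, star_mul, hstarI, neg_mul, mul_neg, neg_inj] at h
    exact h.symm
  have hJ' : star y * φ qJ = φ qJ * star y := by
    have h := congrArg star hJ
    rw [star_mul, star_mul, hstarJ, neg_mul, mul_neg, neg_inj] at h
    exact h.symm
  set d := y - star y with hd
  have hdI : d * φ qI = φ qI * d := by rw [hd, sub_mul, mul_sub, hI, hI']
  have hdJ : d * φ qJ = φ qJ * d := by rw [hd, sub_mul, mul_sub, hJ, hJ']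
  have hsa : star (φ qI * d) = φ qI * d := by
    rw [star_mul, hstarI, ← hdI, hd, star_sub, star_star, mul_neg, ← neg_mul, neg_sub]
  have h := hquasi _ hsa qJ
  rw [mul_assoc, hdJ, ← mul_assoc, ← mul_assoc, ← map_mul, ← map_mul, h4, h5, map_neg,
    neg_mul] at h
  have h' : (2 : ℝ) • (φ qK * d) = 0 := by rw [two_smul]; nth_rw 1 [h]; exact neg_add_cancel _
  have h0 : φ qK * d = 0 := (smul_eq_zero.1 h').resolve_left two_ne_zero
  have hd0 : -d = 0 := by
    rw [← neg_one_mul d, ← map_one φ, ← map_neg, ← h3, map_mul, mul_assoc, h0, mul_zero]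
  exact (sub_eq_zero.1 (neg_eq_zero.1 hd0)).symm

end QuaternionDecomposition

theorem norm_fourRe_le {A : Type*} [NormedRing A] [NormedAlgebra ℝ A] {φ : ℍ →ₐ[ℝ] A}
    (hφ : ∀ z : ℍ, ‖φ z‖ = ‖z‖) (x : A) : ‖fourRe φ x‖ ≤ 4 * ‖x‖ := by
  obtain ⟨s1, s2, s3⟩ := star_quaternion_units
  obtain ⟨m1, m2, m3, -⟩ := quaternion_units_mul
  have hconj (q : ℍ) (hq : star q = -q) (hq' : q * q = -1) : ‖φ q * (x * φ q)‖ ≤ ‖x‖ := by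
    have hn : ‖φ q‖ = 1 := by
      have h := CStarRing.norm_star_mul_self (x := q)
      rw [hq, neg_mul, hq', neg_neg, norm_one] at h
      rw [hφ]
      nlinarith [norm_nonneg q]
    calc ‖φ q * (x * φ q)‖ ≤ ‖φ q‖ * (‖x‖ * ‖φ q‖) :=
          (norm_mul_le _ _).trans (by gcongr; exact norm_mul_le _ _)
      _ = ‖x‖ := by rw [hn, one_mul, mul_one]
  refine (norm_sub_le _ _).trans ?_
  have h1 := hconj qI s1 m1
  have h2 := hconj qJ s2 m2
  have h3 := hconj qK s3 m3
  have h4 := norm_sub_le (x - φ qI * (x * φ qI))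
    (φ qJ * (x * φ qJ))
  have h5 := norm_sub_le x (φ qI * (x * φ qI))
  linarith

theorem exists_quaternion_phase (q : ℍ) :
    ∃ u : ℍ, ‖u‖ ≤ 1 ∧ u * q = algebraMap ℝ ℍ ‖q‖ ∧ q * u = algebraMap ℝ ℍ ‖q‖ := by
  have h : ‖q‖⁻¹ * (‖q‖ * ‖q‖) = ‖q‖ := by
    rcases eq_or_ne ‖q‖ 0 with h0 | h0
    · simp [h0]
    · field_simp
  refine ⟨‖q‖⁻¹ • star q, ?_, ?_, ?_⟩
  · rw [norm_smul, norm_inv, norm_norm, norm_star]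
    exact inv_mul_le_one
  · rw [smul_mul_assoc, Quaternion.star_mul_self, Quaternion.normSq_eq_norm_mul_self,
      ← Quaternion.coe_smul, smul_eq_mul, h, Quaternion.algebraMap_def]
  · rw [mul_smul_comm, Quaternion.self_mul_star, Quaternion.normSq_eq_norm_mul_self,
      ← Quaternion.coe_smul, smul_eq_mul, h, Quaternion.algebraMap_def]

theorem map_sub_of_map_add {A B : Type*} [AddGroup A] [AddGroup B] {M : AddSubgroup A}
    {ρ : A → B} (hadd : ∀ x ∈ M, ∀ y ∈ M, ρ (x + y) = ρ x + ρ y) {x y : A} (hx : x ∈ M)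
    (hy : y ∈ M) : ρ (x - y) = ρ x - ρ y := by
  rw [eq_sub_iff_add_eq, ← hadd _ (M.sub_mem hx hy) _ hy, sub_add_cancel]

section Functionals

variable {A : Type*} [NormedRing A] [NormedAlgebra ℝ A] [CompleteSpace A] [StarRing A]
    {φ : ℍ →ₐ[ℝ] A} (hφ : ∀ z : ℍ, ‖φ z‖ = ‖z‖)
    (hCstar : ∀ x : A, ‖star x * x‖ = ‖x‖ ^ 2)
    (hφstar : ∀ z : ℍ, φ (star z) = star (φ z))
    (hquasi : ∀ x : A, star x = x → ∀ a : ℍ, x * φ a = φ a * x)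
    {M : AddSubgroup A} (hone : (1 : A) ∈ M)
    (hleft : ∀ (a : ℍ), ∀ x ∈ M, φ a * x ∈ M)
    {ρ : A → ℍ} (hadd : ∀ x ∈ M, ∀ y ∈ M, ρ (x + y) = ρ x + ρ y)
    (hscal : ∀ q : ℍ, ∀ e ∈ M, (∀ a, e * φ a = φ a * e) → ∀ r : ℝ, ρ e = algebraMap ℝ ℍ r →
      ρ (φ q * e) = q * algebraMap ℝ ℍ r)

include hφ hCstar hφstar hquasi hone hleft hadd hscal

theorem exists_bound_of_nonneg (hright : ∀ (a : ℍ), ∀ x ∈ M, x * φ a ∈ M)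
    (hphase : ∀ x ∈ M, ∃ y ∈ M, ‖y‖ ≤ ‖x‖ ∧ ρ y = algebraMap ℝ ℍ ‖ρ x‖)
    (hpos : ∀ x ∈ M, star x = x →
      (∀ z ∈ qSpectrum φ x, ∃ r : ℝ, 0 ≤ r ∧ z = algebraMap ℝ ℍ r) →
        ∃ r : ℝ, 0 ≤ r ∧ ρ x = algebraMap ℝ ℍ r) :
    ∃ c : ℝ, ρ 1 = algebraMap ℝ ℍ c ∧ ∀ x ∈ M, ‖ρ x‖ ≤ c * ‖x‖ := by
  have halg (t : ℝ) : algebraMap ℝ A t ∈ M := by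
    have h := hleft (algebraMap ℝ ℍ t) 1 hone
    rwa [mul_one, AlgHom.commutes] at h
  obtain ⟨c, hc0, hc⟩ := hpos 1 hone (star_one A) fun z hz =>
    nonneg_of_mem_qSpectrum_algebraMap_sub hφ hCstar hφstar (b := 0) (t := 1) (star_zero A)
      (by simp) (by simp) (by simpa using hz)
  have hρalg (t : ℝ) : ρ (algebraMap ℝ A t) = algebraMap ℝ ℍ (t * c) := by
    have h := hscal (algebraMap ℝ ℍ t) 1 hone (by simp) c hc
    rwa [mul_one, AlgHom.commutes, ← map_mul] at h
  have hsa {b : A} (hbM : b ∈ M) (hb : star b = b) :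
      ∃ r : ℝ, r ≤ c * ‖b‖ ∧ ρ b = algebraMap ℝ ℍ r := by
    obtain ⟨r, hr0, hr⟩ := hpos (algebraMap ℝ A ‖b‖ - b) (M.sub_mem (halg _) hbM)
      (by rw [star_sub, hb, star_algebraMap_real hφstar]) fun z hz =>
        nonneg_of_mem_qSpectrum_algebraMap_sub hφ hCstar hφstar hb (hquasi b hb) le_rfl hz
    rw [map_sub_of_map_add hadd (halg _) hbM, hρalg, sub_eq_iff_eq_add, ← sub_eq_iff_eq_add',
      ← map_sub] at hr
    exact ⟨_, by linarith, hr.symm⟩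
  refine ⟨c, hc, fun x hx => ?_⟩
  obtain ⟨y, hy, hyx, hρy⟩ := hphase x hx
  have hfM {x : A} (hx : x ∈ M) : fourRe φ x ∈ M :=
    M.sub_mem (M.sub_mem (M.sub_mem hx (hleft _ _ (hright _ _ hx)))
      (hleft _ _ (hright _ _ hx))) (hleft _ _ (hright _ _ hx))
  have hfsa (x : A) : star (fourRe φ x) = fourRe φ x :=
    star_eq_of_commute_units hφstar hquasi (fourRe_commute φ x).1 (fourRe_commute φ x).2
  have hunit (q : ℍ) : φ q * fourRe φ (φ q * y) ∈ M := hleft _ _ (hfM (hleft _ _ hy))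
  have hρunit (q : ℍ) : ∃ s : ℝ, ρ (φ q * fourRe φ (φ q * y)) = q * algebraMap ℝ ℍ s := by
    obtain ⟨s, -, hs⟩ := hsa (hfM (hleft q _ hy)) (hfsa _)
    exact ⟨s, hscal _ _ (hfM (hleft q _ hy)) (hquasi _ (hfsa _)) _ hs⟩
  obtain ⟨s, hs, hρs⟩ := hsa (hfM hy) (hfsa y)
  obtain ⟨sI, hI⟩ := hρunit qI
  obtain ⟨sJ, hJ⟩ := hρunit qJ
  obtain ⟨sK, hK⟩ := hρunit qK
  have hdec := congrArg ρ (fourRe_decomposition φ y)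
  have h4 : ρ ((4 : ℕ) • y) = (4 : ℝ) • ρ y := by
    rw [show (4 : ℕ) • y = (y + y) + (y + y) by abel, hadd _ (M.add_mem hy hy) _ (M.add_mem hy hy),
      hadd _ hy _ hy]
    module
  rw [map_sub_of_map_add hadd (M.sub_mem (M.sub_mem (hfM hy) (hunit _)) (hunit _)) (hunit _),
    map_sub_of_map_add hadd (M.sub_mem (hfM hy) (hunit _)) (hunit _),
    map_sub_of_map_add hadd (hfM hy) (hunit _), hρs, hI, hJ, hK, h4, hρy] at hdec
  have hre := congrArg QuaternionAlgebra.re hdec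
  simp [Quaternion.algebraMap_def] at hre
  have hle := norm_fourRe_le hφ y
  nlinarith [mul_le_mul_of_nonneg_left hle hc0, mul_le_mul_of_nonneg_left hyx hc0]

theorem nonneg_of_bound {c : ℝ} (hc : ρ 1 = algebraMap ℝ ℍ c)
    (hbound : ∀ x ∈ M, ‖ρ x‖ ≤ c * ‖x‖) {x : A} (hx : x ∈ M) (hxsa : star x = x)
    (hspec : ∀ z ∈ qSpectrum φ x, ∃ r : ℝ, 0 ≤ r ∧ z = algebraMap ℝ ℍ r) :
    ∃ r : ℝ, 0 ≤ r ∧ ρ x = algebraMap ℝ ℍ r := by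
  have hφM (q : ℍ) : φ q ∈ M := by simpa using hleft q 1 hone
  have hρφ (q : ℍ) : ρ (φ q) = q * algebraMap ℝ ℍ c := by
    simpa using hscal q 1 hone (by simp) c hc
  have hc0 : 0 ≤ c := by
    by_contra! h
    have h0 := hbound _ (hφM 1)
    rw [hφ, norm_one, mul_one] at h0
    exact absurd (h0.trans_lt h) (norm_nonneg _).not_gt
  set p := ρ x with hp
  set v : ℍ := p.im with hv
  have hvstar : star v = -v := Quaternion.star_im p
  have hvv : v * v = -algebraMap ℝ ℍ (Quaternion.normSq v) := by
    rw [Quaternion.algebraMap_def, ← Quaternion.self_mul_star, hvstar, mul_neg, neg_neg]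
  have hnormx (t : ℝ) : ‖x + φ (t • v)‖ ^ 2 ≤ ‖x‖ ^ 2 + t ^ 2 * Quaternion.normSq v := by
    have hprod : star (x + φ (t • v)) * (x + φ (t • v)) =
        x * x + φ (algebraMap ℝ ℍ (t ^ 2 * Quaternion.normSq v)) := by
      have hstar : star (φ (t • v)) = -φ (t • v) := by
        rw [← hφstar, Quaternion.star_smul, hvstar, smul_neg, map_neg]
      have hsq : φ (t • v) * φ (t • v) = -φ (algebraMap ℝ ℍ (t ^ 2 * Quaternion.normSq v)) := by
        rw [← map_mul, smul_mul_smul_comm, hvv, smul_neg, map_neg, ← sq, map_mul (algebraMap ℝ ℍ),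
          ← Algebra.smul_def]
      rw [star_add, hxsa, hstar, add_mul, mul_add, mul_add, neg_mul, neg_mul, hsq, neg_neg,
        hquasi x hxsa]
      abel
    rw [← hCstar, hprod]
    refine (norm_add_le _ _).trans <| add_le_add ((norm_mul_le _ _).trans (sq ‖x‖).ge) ?_
    rw [hφ, Quaternion.algebraMap_def, Quaternion.norm_coe, Real.norm_of_nonneg]
    exact mul_nonneg (sq_nonneg t) Quaternion.normSq_nonneg
  have hineq (t : ℝ) : p.re ^ 2 + (1 + c * t) ^ 2 * Quaternion.normSq v ≤
      c ^ 2 * (‖x‖ ^ 2 + t ^ 2 * Quaternion.normSq v) := by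
    have h1 := hbound _ (M.add_mem hx (hφM (t • v)))
    have h2 : ‖ρ (x + φ (t • v))‖ ^ 2 = p.re ^ 2 + (1 + c * t) ^ 2 * Quaternion.normSq v := by
      rw [hadd _ hx _ (hφM _), hρφ, sq, ← Quaternion.normSq_eq_norm_mul_self]
      simp [Quaternion.normSq_def', Quaternion.algebraMap_def, hv]
      ring
    calc _ = ‖ρ (x + φ (t • v))‖ ^ 2 := h2.symm
      _ ≤ (c * ‖x + φ (t • v)‖) ^ 2 := pow_le_pow_left₀ (norm_nonneg _) h1 2
      _ = c ^ 2 * ‖x + φ (t • v)‖ ^ 2 := mul_pow _ _ _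
      _ ≤ _ := mul_le_mul_of_nonneg_left (hnormx t) (sq_nonneg c)
  have hv0 : Quaternion.normSq v = 0 := by
    have hn : 0 ≤ Quaternion.normSq v := Quaternion.normSq_nonneg
    by_contra hne
    have hn' : 0 < Quaternion.normSq v := lt_of_le_of_ne hn (Ne.symm hne)
    rcases hc0.eq_or_lt with h0 | hcpos
    · have h := hineq 0
      rw [← h0] at h
      nlinarith [sq_nonneg p.re]
    · have h := hineq ((c ^ 2 * ‖x‖ ^ 2) / (2 * c * Quaternion.normSq v))
      have h2 : 2 * c * (c ^ 2 * ‖x‖ ^ 2 / (2 * c * Quaternion.normSq v)) * Quaternion.normSq v =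
          c ^ 2 * ‖x‖ ^ 2 := by field_simp
      nlinarith [sq_nonneg p.re]
  have hpre : p = algebraMap ℝ ℍ p.re := by
    rw [Quaternion.normSq_eq_zero, hv] at hv0
    rw [Quaternion.algebraMap_def]
    conv_lhs => rw [← Quaternion.re_add_im p, hv0, add_zero]
  refine ⟨p.re, ?_, hpre⟩
  have halgM : algebraMap ℝ A ‖x‖ ∈ M := AlgHom.commutes φ ‖x‖ ▸ hφM (algebraMap ℝ ℍ ‖x‖)
  have h := (hbound _ (M.sub_mem halgM hx)).trans (mul_le_mul_of_nonneg_left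
    (norm_algebraMap_norm_sub_le hφ hCstar hφstar hxsa (hquasi x hxsa) hspec) hc0)
  rw [map_sub_of_map_add hadd halgM hx, ← AlgHom.commutes φ, hρφ, ← hp, hpre, ← map_mul,
    ← map_sub, Quaternion.algebraMap_def, Quaternion.norm_coe, Real.norm_eq_abs] at h
  linarith [le_abs_self (‖x‖ * c - p.re)]

end Functionals

/-- Let `M` be a selfadjoint ℍ-subspace with unit of a C*-algebra over ℍ satisfying
the quasicommutativity hypothesis, and let `ρ : M → ℍ` be additive and left or right
ℍ-linear. Then `ρ` is nonnegative (maps nonnegative selfadjoint elements of `M` to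
nonnegative reals) iff `ρ` is bounded with `‖ρ‖ = ρ(1)`. -/
theorem stmt_13 {A : Type*} [NormedRing A] [NormedAlgebra ℝ A] [CompleteSpace A]
    [NormOneClass A] [StarRing A]
    (φ : ℍ →ₐ[ℝ] A) (hφ : ∀ z : ℍ, ‖φ z‖ = ‖z‖)
    (hCstar : ∀ x : A, ‖star x * x‖ = ‖x‖ ^ 2)
    (hφstar : ∀ z : ℍ, φ (star z) = star (φ z))
    (hquasi : ∀ x : A, star x = x → ∀ a : ℍ, x * φ a = φ a * x)
    (M : AddSubgroup A) (hone : (1 : A) ∈ M)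
    (hstar : ∀ x ∈ M, star x ∈ M)
    (hleft : ∀ (a : ℍ), ∀ x ∈ M, φ a * x ∈ M)
    (hright : ∀ (a : ℍ), ∀ x ∈ M, x * φ a ∈ M)
    (ρ : A → ℍ)
    (hadd : ∀ x ∈ M, ∀ y ∈ M, ρ (x + y) = ρ x + ρ y)
    (hlin : (∀ (a : ℍ), ∀ x ∈ M, ρ (φ a * x) = a * ρ x) ∨
            (∀ (a : ℍ), ∀ x ∈ M, ρ (x * φ a) = ρ x * a)) :
    (∀ x ∈ M, star x = x → (∀ z ∈ qSpectrum φ x, ∃ r : ℝ, 0 ≤ r ∧ z = algebraMap ℝ ℍ r) →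
        ∃ r : ℝ, 0 ≤ r ∧ ρ x = algebraMap ℝ ℍ r) ↔
      (BddAbove {r : ℝ | ∃ x ∈ M, ‖x‖ ≤ 1 ∧ r = ‖ρ x‖} ∧
        ρ 1 = algebraMap ℝ ℍ (sSup {r : ℝ | ∃ x ∈ M, ‖x‖ ≤ 1 ∧ r = ‖ρ x‖})) := by
  have hscal : ∀ q : ℍ, ∀ e ∈ M, (∀ a, e * φ a = φ a * e) → ∀ r : ℝ, ρ e = algebraMap ℝ ℍ r →
      ρ (φ q * e) = q * algebraMap ℝ ℍ r := by
    intro q e he hcomm r hr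
    rcases hlin with h | h
    · rw [h q e he, hr]
    · rw [← hcomm, h q e he, hr, Algebra.commutes]
  have hphase : ∀ x ∈ M, ∃ y ∈ M, ‖y‖ ≤ ‖x‖ ∧ ρ y = algebraMap ℝ ℍ ‖ρ x‖ := by
    intro x hx
    obtain ⟨u, hu, hu1, hu2⟩ := exists_quaternion_phase (ρ x)
    rcases hlin with h | h
    · refine ⟨φ u * x, hleft _ _ hx, (norm_mul_le _ _).trans ?_, by rw [h u x hx, hu1]⟩
      rw [hφ]
      exact mul_le_of_le_one_left (norm_nonneg x) hu
    · refine ⟨x * φ u, hright _ _ hx, (norm_mul_le _ _).trans ?_, by rw [h u x hx, hu2]⟩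
      rw [hφ]
      exact mul_le_of_le_one_right (norm_nonneg x) hu
  have hreal (t : ℝ) {x : A} (hx : x ∈ M) : t • x ∈ M ∧ ρ (t • x) = t • ρ x := by
    have hl : t • x = φ (algebraMap ℝ ℍ t) * x := by rw [AlgHom.commutes, Algebra.smul_def]
    have hr : t • x = x * φ (algebraMap ℝ ℍ t) := by
      rw [hl, AlgHom.commutes, Algebra.commutes]
    refine ⟨hl ▸ hleft _ _ hx, ?_⟩
    rcases hlin with h | h
    · rw [hl, h _ x hx, Algebra.smul_def]
    · rw [hr, h _ x hx, Algebra.smul_def, Algebra.commutes]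
  constructor
  · intro hpos
    obtain ⟨c, hc, hbound⟩ := exists_bound_of_nonneg hφ hCstar hφstar hquasi hone hleft hadd
      hscal hright hphase hpos
    have hc0 : 0 ≤ c := by simpa using (norm_nonneg _).trans (hbound 1 hone)
    have hgreatest : IsGreatest {r : ℝ | ∃ x ∈ M, ‖x‖ ≤ 1 ∧ r = ‖ρ x‖} c := by
      refine ⟨⟨1, hone, norm_one.le, ?_⟩, ?_⟩
      · rw [hc, Quaternion.algebraMap_def, Quaternion.norm_coe, Real.norm_of_nonneg hc0]
      · rintro _ ⟨x, hx, hx1, rfl⟩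
        exact (hbound x hx).trans (mul_le_of_le_one_right hc0 hx1)
    exact ⟨hgreatest.bddAbove, by rw [hgreatest.csSup_eq, hc]⟩
  · rintro ⟨hbdd, hc⟩ x hx hxsa hspec
    refine nonneg_of_bound hφ hCstar hφstar hquasi hone hleft hadd hscal hc (fun x hx => ?_)
      hx hxsa hspec
    rcases eq_or_ne x 0 with rfl | hx0
    · have h := (hreal 0 hone).2
      rw [zero_smul, zero_smul] at h
      simp [h]
    · have hnorm := norm_pos_iff.2 hx0
      have h := le_csSup hbdd ⟨‖x‖⁻¹ • x, (hreal _ hx).1, by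
        rw [norm_smul, norm_inv, norm_norm, inv_mul_cancel₀ hnorm.ne'], rfl⟩
      rwa [(hreal _ hx).2, norm_smul, norm_inv, norm_norm, inv_mul_le_iff₀ hnorm, mul_comm] at h
end

section
/- Let V be a compact Hausdorff space. (a) If J is a norm-closed two-sided ideal of the ring C(V, ℍ) and S := {v ∈ V : f(v) = 0 for all f ∈ J}, then S is a closed subset of V and J = {f ∈ C(V, ℍ) : f(v) = 0 for all v ∈ S}. (b) Conversely, for every closed subset S ⊆ V the set {f ∈ C(V, ℍ) : f(v) = 0 for all v ∈ S} is a norm-closed two-sided ideal of C(V, ℍ). (c) A proper norm-closed two-sided ideal J of C(V, ℍ) is a maximal two-sided ideal if and only if the corresponding set S is a singleton. -/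
local notation "ℍ" => Quaternion ℝ

variable {V : Type*} [TopologicalSpace V] [CompactSpace V] [T2Space V]

/-- A two-sided ideal of the ring `C(V, ℍ)`, as a set. -/
def IsTwoSidedIdealSet (J : Set (ContinuousMap V ℍ)) : Prop :=
  (0 : ContinuousMap V ℍ) ∈ J ∧
  (∀ f ∈ J, ∀ g ∈ J, f + g ∈ J) ∧
  (∀ f ∈ J, -f ∈ J) ∧
  (∀ f ∈ J, ∀ g : ContinuousMap V ℍ, g * f ∈ J ∧ f * g ∈ J)

/-- A maximal two-sided ideal of `C(V, ℍ)`: a proper two-sided ideal such that every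
two-sided ideal containing it equals it or the whole ring. -/
def IsMaximalTwoSidedIdealSet (J : Set (ContinuousMap V ℍ)) : Prop :=
  IsTwoSidedIdealSet J ∧ J ≠ Set.univ ∧
  ∀ J' : Set (ContinuousMap V ℍ), IsTwoSidedIdealSet J' → J ⊆ J' →
    J' = J ∨ J' = Set.univ

/-- A real-valued function, regarded as a quaternion-valued one. -/
def quaternionOfReal {X : Type*} [TopologicalSpace X]
    (p : C(X, ℝ)) : ContinuousMap X ℍ :=
  ⟨fun v => (p v : ℍ), Quaternion.continuous_coe.comp p.continuous⟩

lemma quaternionOfReal_normSq_mem {X : Type*} [TopologicalSpace X]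
    {J : Set (ContinuousMap X ℍ)} (hJ : IsTwoSidedIdealSet J)
    {g : ContinuousMap X ℍ} (hg : g ∈ J) :
    quaternionOfReal ⟨fun v => Quaternion.normSq (g v),
      Quaternion.continuous_normSq.comp g.continuous⟩ ∈ J := by
  convert (hJ.2.2.2 g hg ⟨fun v => star (g v), continuous_star.comp g.continuous⟩).1 using 1
  refine ContinuousMap.ext fun v => ?_
  exact (Quaternion.star_mul_self (g v)).symm

/-- On a compact set where the ideal has no common zero, the ideal contains a nonnegative real
function which is positive on that set. -/
lemma exists_quaternionOfReal_mem_pos {X : Type*} [TopologicalSpace X]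
    {J : Set (ContinuousMap X ℍ)} (hJ : IsTwoSidedIdealSet J)
    {K : Set X} (hK : IsCompact K) (hKJ : ∀ v ∈ K, ∃ g ∈ J, g v ≠ 0) :
    ∃ p : C(X, ℝ), quaternionOfReal p ∈ J ∧ (∀ v, 0 ≤ p v) ∧ ∀ v ∈ K, 0 < p v := by
  refine hK.induction_on (p := fun s => ∃ p : C(X, ℝ), quaternionOfReal p ∈ J ∧
    (∀ v, 0 ≤ p v) ∧ ∀ v ∈ s, 0 < p v) ?_ ?_ ?_ ?_
  · refine ⟨0, ?_, fun v => le_rfl, by simp⟩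
    convert hJ.1 using 1
    exact ContinuousMap.ext fun v => by simp [quaternionOfReal]
  · rintro s t hst ⟨p, hp, hp0, hpt⟩
    exact ⟨p, hp, hp0, fun v hv => hpt v (hst hv)⟩
  · rintro s t ⟨p, hp, hp0, hps⟩ ⟨q, hq, hq0, hqt⟩
    refine ⟨p + q, ?_, fun v => add_nonneg (hp0 v) (hq0 v), ?_⟩
    · convert hJ.2.1 _ hp _ hq using 1
      exact ContinuousMap.ext fun v => by simp [quaternionOfReal]
    · rintro v (hv | hv)
      · exact add_pos_of_pos_of_nonneg (hps v hv) (hq0 v)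
      · exact add_pos_of_nonneg_of_pos (hp0 v) (hqt v hv)
  · intro v hv
    obtain ⟨g, hg, hgv⟩ := hKJ v hv
    refine ⟨{w | g w ≠ 0}, mem_nhdsWithin_of_mem_nhds
      ((isOpen_ne_fun g.continuous continuous_const).mem_nhds hgv), _,
      quaternionOfReal_normSq_mem hJ hg, fun w => Quaternion.normSq_nonneg, fun w hw => ?_⟩
    exact lt_of_le_of_ne Quaternion.normSq_nonneg (Ne.symm (Quaternion.normSq_ne_zero.2 hw))

/-- A function vanishing at the common zeros of an ideal lies in the closure of the ideal. -/
lemma mem_closure_of_eq_zero_of_common_zero {X : Type*} [TopologicalSpace X] [CompactSpace X]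
    {J : Set (ContinuousMap X ℍ)}
    (hJ : IsTwoSidedIdealSet J) {f : ContinuousMap X ℍ}
    (hf : ∀ v, (∀ g ∈ J, g v = 0) → f v = 0) : f ∈ closure J := by
  rw [Metric.mem_closure_iff]
  intro ε hε
  have hK : IsCompact {v | ε ≤ ‖f v‖} :=
    (isClosed_le continuous_const f.continuous.norm).isCompact
  obtain ⟨p, hpJ, hp0, hpK⟩ := exists_quaternionOfReal_mem_pos hJ hK (fun v hv => by
    by_contra! h
    have hv' : ε ≤ ‖f v‖ := hv
    rw [hf v h, norm_zero] at hv'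
    exact hε.not_ge hv')
  obtain ⟨c, hc, hcK⟩ : ∃ c > 0, ∀ v ∈ {v | ε ≤ ‖f v‖}, c ≤ p v := by
    rcases Set.eq_empty_or_nonempty {v | ε ≤ ‖f v‖} with h | h
    · exact ⟨1, one_pos, by simp [h]⟩
    · obtain ⟨w, hw, hmin⟩ := hK.exists_isMinOn h p.continuous.continuousOn
      exact ⟨p w, hpK w hw, fun v hv => hmin hv⟩
  obtain ⟨n, hn⟩ := exists_nat_gt (‖f‖ / (ε * c))
  have hn' : ‖f‖ < n * (ε * c) := (div_lt_iff₀ (by positivity)).1 hn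
  have hpos : ∀ v, 0 < 1 + n * p v := fun v => by have := hp0 v; positivity
  let u : C(X, ℝ) := ⟨fun v => n / (1 + n * p v),
    continuous_const.div (by fun_prop) fun v => (hpos v).ne'⟩
  refine ⟨f * quaternionOfReal u * quaternionOfReal p, (hJ.2.2.2 _ hpJ _).1, ?_⟩
  rw [ContinuousMap.dist_lt_iff hε]
  intro v
  have hsub : f v - (f * quaternionOfReal u * quaternionOfReal p) v
      = f v * (((1 + n * p v)⁻¹ : ℝ) : ℍ) := by
    have h : (1 : ℝ) - n / (1 + n * p v) * p v = (1 + n * p v)⁻¹ := by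
      have := (hpos v).ne'
      field_simp
      ring
    rw [← h]
    simp [quaternionOfReal, u, mul_sub, mul_assoc]
  rw [dist_eq_norm, hsub, norm_mul, Quaternion.norm_coe, Real.norm_of_nonneg
    (inv_nonneg.2 (hpos v).le), ← div_eq_mul_inv, div_lt_iff₀ (hpos v)]
  by_cases hv : ε ≤ ‖f v‖
  · have h1 : ‖f v‖ ≤ ‖f‖ := f.norm_coe_le_norm v
    have h2 : n * (ε * c) ≤ n * (ε * p v) := by
      have := hcK v hv
      gcongr
    linarith
  · have : 0 ≤ ε * (n * p v) := by have := hp0 v; positivity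
    linarith

lemma isTwoSidedIdealSet_vanishing {X : Type*} [TopologicalSpace X]
    (S : Set X) :
    IsTwoSidedIdealSet {f : ContinuousMap X ℍ | ∀ v ∈ S, f v = 0} := by
  refine ⟨fun v _ => rfl, fun f hf g hg v hv => ?_, fun f hf v hv => ?_,
    fun f hf g => ⟨fun v hv => ?_, fun v hv => ?_⟩⟩
  all_goals simp_all

lemma isClosed_vanishing {X : Type*} [TopologicalSpace X]
    (S : Set X) :
    IsClosed {f : ContinuousMap X ℍ | ∀ v ∈ S, f v = 0} := by
  simp only [Set.ofPred_forall]
  exact isClosed_biInter fun v _ =>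
    isClosed_eq (continuous_eval_const v) continuous_const

lemma isClosed_common_zero {X : Type*} [TopologicalSpace X]
    (J : Set (ContinuousMap X ℍ)) :
    IsClosed {v : X | ∀ f ∈ J, f v = 0} := by
  simp only [Set.ofPred_forall]
  exact isClosed_biInter fun f _ => isClosed_eq f.continuous continuous_const

lemma eq_vanishing_common_zero {X : Type*} [TopologicalSpace X] [CompactSpace X]
    {J : Set (ContinuousMap X ℍ)} (hJ : IsTwoSidedIdealSet J)
    (hJc : IsClosed J) :
    J = {f : ContinuousMap X ℍ | ∀ v ∈ {v : X | ∀ g ∈ J, g v = 0}, f v = 0} :=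
  Set.Subset.antisymm (fun f hf _ hv => hv f hf) fun _ hf =>
    hJc.closure_subset (mem_closure_of_eq_zero_of_common_zero hJ hf)

lemma vanishing_singleton_ne_univ {X : Type*} [TopologicalSpace X]
    (v₀ : X) :
    {f : ContinuousMap X ℍ | ∀ v ∈ ({v₀} : Set X), f v = 0} ≠ Set.univ := fun h => by
  have h1 : (1 : ContinuousMap X ℍ) ∈ {f : ContinuousMap X ℍ | ∀ v ∈ ({v₀} : Set X), f v = 0} :=
    h ▸ Set.mem_univ _
  simpa using h1 v₀ rfl

lemma isMaximalTwoSidedIdealSet_vanishing_singleton {X : Type*} [TopologicalSpace X]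
    (v₀ : X) :
    IsMaximalTwoSidedIdealSet {f : ContinuousMap X ℍ | ∀ v ∈ ({v₀} : Set X), f v = 0} := by
  refine ⟨isTwoSidedIdealSet_vanishing _, vanishing_singleton_ne_univ v₀, fun J' hJ' hle => ?_⟩
  by_cases h : ∀ g ∈ J', g v₀ = 0
  · exact Or.inl (Set.Subset.antisymm (fun g hg v hv => by
      rw [Set.mem_singleton_iff.1 hv]; exact h g hg) hle)
  · push Not at h
    obtain ⟨g, hg, hgv⟩ := h
    refine Or.inr (Set.eq_univ_of_forall fun f => ?_)
    have h1 := (hJ'.2.2.2 g hg (ContinuousMap.const X (f v₀ * (g v₀)⁻¹))).1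
    have h2 : f - ContinuousMap.const X (f v₀ * (g v₀)⁻¹) * g ∈ J' := hle fun v hv => by
      rw [Set.mem_singleton_iff.1 hv]
      simp [mul_assoc, inv_mul_cancel₀ hgv]
    simpa using hJ'.2.1 _ h2 _ h1

lemma common_zero_vanishing_singleton {X : Type*} [TopologicalSpace X] [CompactSpace X] [T2Space X]
    (v₀ : X) :
    {v : X | ∀ f ∈ {f : ContinuousMap X ℍ | ∀ v ∈ ({v₀} : Set X), f v = 0}, f v = 0} = {v₀} := by
  refine Set.Subset.antisymm (fun v hv => ?_) fun v hv f hf => hf v hv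
  by_contra hne
  obtain ⟨p, hp0, hp1, -⟩ := exists_continuous_zero_one_of_isClosed
    (isClosed_singleton (x := v₀)) (isClosed_singleton (x := v))
    (Set.disjoint_singleton.2 (Ne.symm hne))
  have h := hv (quaternionOfReal p) fun w hw => by simp [quaternionOfReal, hp0 hw]
  simp [quaternionOfReal, hp1 (Set.mem_singleton v)] at h

/-- (a) Every norm-closed two-sided ideal `J` of `C(V, ℍ)` is the ideal of functions
vanishing on the closed set `S := {v : f v = 0 ∀ f ∈ J}`; (b) conversely, functions
vanishing on a closed set form a norm-closed two-sided ideal; (c) a proper closed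
two-sided ideal is maximal iff the corresponding `S` is a singleton. -/
theorem stmt_14 :
    (∀ J : Set (ContinuousMap V ℍ), IsTwoSidedIdealSet J → IsClosed J →
      IsClosed {v : V | ∀ f ∈ J, f v = 0} ∧
      J = {f : ContinuousMap V ℍ | ∀ v ∈ {v : V | ∀ g ∈ J, g v = 0}, f v = 0}) ∧
    (∀ S : Set V, IsClosed S →
      IsTwoSidedIdealSet {f : ContinuousMap V ℍ | ∀ v ∈ S, f v = 0} ∧
      IsClosed {f : ContinuousMap V ℍ | ∀ v ∈ S, f v = 0}) ∧
    (∀ J : Set (ContinuousMap V ℍ), IsTwoSidedIdealSet J → IsClosed J → J ≠ Set.univ →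
      (IsMaximalTwoSidedIdealSet J ↔ ∃ v₀ : V, {v : V | ∀ f ∈ J, f v = 0} = {v₀})) := by
  refine ⟨fun J hJ hJc => ⟨isClosed_common_zero J, eq_vanishing_common_zero hJ hJc⟩,
    fun S _ => ⟨isTwoSidedIdealSet_vanishing S, isClosed_vanishing S⟩, fun J hJ hJc hne => ?_⟩
  have hJeq := eq_vanishing_common_zero hJ hJc
  constructor
  · rintro ⟨-, -, hmax⟩
    obtain ⟨v₀, hv₀⟩ : {v : V | ∀ f ∈ J, f v = 0}.Nonempty := by
      by_contra h
      rw [Set.not_nonempty_iff_eq_empty.1 h] at hJeq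
      exact hne (by simpa using hJeq)
    refine ⟨v₀, ?_⟩
    rcases hmax _ (isTwoSidedIdealSet_vanishing {v₀}) (fun f hf v hv => by
      rw [Set.mem_singleton_iff.1 hv]; exact hv₀ f hf) with h | h
    · rw [← h]
      exact common_zero_vanishing_singleton v₀
    · exact absurd h (vanishing_singleton_ne_univ v₀)
  · rintro ⟨v₀, hv₀⟩
    rw [hJeq, hv₀]
    exact isMaximalTwoSidedIdealSet_vanishing_singleton v₀
end

section
/- Let V be a compact Hausdorff space and let p : C(V, ℍ) → ℍ be a nonzero continuous quasilinear functional that is multiplicative, i.e. p(f·g) = p(f)·p(g) for all f, g ∈ C(V, ℍ). Then there exist a point z₀ ∈ V and a ring automorphism θ : ℍ → ℍ such that p(f) = θ(f(z₀)) for every f ∈ C(V, ℍ). -/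
local notation "ℍ" => Quaternion ℝ

/-- The kernel of a unital multiplicative functional on `C(V, ℍ)` has a common zero. -/
theorem exists_common_zero_of_map_eq_zero {V : Type*} [TopologicalSpace V] [CompactSpace V]
    (p : ContinuousMap V ℍ →ₗ[ℝ] ℍ) (hone : p 1 = 1)
    (hmul : ∀ f g : ContinuousMap V ℍ, p (f * g) = p f * p g) :
    ∃ z₀ : V, ∀ f : ContinuousMap V ℍ, p f = 0 → f z₀ = 0 := by
  by_contra! h
  choose F hF hFz using h
  obtain ⟨t, -, ht⟩ := isCompact_univ.elim_nhds_subcover (fun z => {x | F z x ≠ 0})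
    fun z _ => (isOpen_ne_fun (F z).continuous continuous_const).mem_nhds (hFz z)
  set g : ContinuousMap V ℍ := ∑ z ∈ t, star (F z) * F z with hg
  have hgx (x : V) : g x = algebraMap ℝ ℍ (∑ z ∈ t, Quaternion.normSq (F z x)) := by
    rw [hg, ContinuousMap.sum_apply, map_sum]
    exact Finset.sum_congr rfl fun z _ => Quaternion.star_mul_self _
  have hgne (x : V) : g x ≠ 0 := by
    obtain ⟨z, hz, hzx⟩ := Set.mem_iUnion₂.mp (ht (Set.mem_univ x))
    have hpos : 0 < ∑ z ∈ t, Quaternion.normSq (F z x) :=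
      Finset.sum_pos' (fun _ _ => Quaternion.normSq_nonneg)
        ⟨z, hz, Quaternion.normSq_nonneg.lt_of_ne' (Quaternion.normSq_ne_zero.mpr hzx)⟩
    rw [hgx]
    exact (map_ne_zero (algebraMap ℝ ℍ)).mpr hpos.ne'
  have hpg : p g = 0 := by
    rw [hg, map_sum]
    exact Finset.sum_eq_zero fun z _ => by rw [hmul, hF, mul_zero]
  have hginv : g * ⟨fun x => (g x)⁻¹, g.continuous.inv₀ hgne⟩ = 1 := by
    ext1 x
    exact mul_inv_cancel₀ (hgne x)
  have := hmul g ⟨fun x => (g x)⁻¹, g.continuous.inv₀ hgne⟩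
  rw [hginv, hone, hpg, zero_mul] at this
  exact one_ne_zero this

/-- Every nonzero continuous multiplicative quasilinear functional on `C(V, ℍ)`
(`V` compact Hausdorff) is of the form `f ↦ θ (f z₀)` for a point `z₀ ∈ V` and a
ring automorphism `θ` of ℍ. -/
theorem stmt_15 {V : Type*} [TopologicalSpace V] [CompactSpace V] [T2Space V]
    (p : ContinuousMap V ℍ →ₗ[ℝ] ℍ) (hcont : Continuous p) (hne : p ≠ 0)
    (hmul : ∀ f g : ContinuousMap V ℍ, p (f * g) = p f * p g) :
    ∃ (z₀ : V) (θ : ℍ ≃+* ℍ), ∀ f : ContinuousMap V ℍ, p f = θ (f z₀) := by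
  have hone : p 1 = 1 := by
    obtain ⟨f, hf⟩ := DFunLike.ne_iff.mp hne
    refine mul_left_cancel₀ hf ?_
    rw [← hmul, mul_one, mul_one]
  obtain ⟨z₀, hz₀⟩ := exists_common_zero_of_map_eq_zero p hone hmul
  let φ : ℍ →ₐ[ℝ] ℍ := AlgHom.ofLinearMap
    { toFun := fun q => p (ContinuousMap.const V q)
      map_add' := fun a b => map_add p (ContinuousMap.const V a) (ContinuousMap.const V b)
      map_smul' := fun c a => map_smul p c (ContinuousMap.const V a) }
    hone fun a b => hmul (ContinuousMap.const V a) (ContinuousMap.const V b)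
  have hinj : Function.Injective φ := φ.toRingHom.injective
  have hsurj : Function.Surjective φ :=
    LinearMap.surjective_of_injective (f := φ.toLinearMap) hinj
  refine ⟨z₀, RingEquiv.ofBijective φ ⟨hinj, hsurj⟩, fun f => ?_⟩
  obtain ⟨q, hq⟩ := hsurj (p f)
  have hfq : f z₀ - q = 0 := hz₀ (f - ContinuousMap.const V q) <| by
    rw [map_sub, sub_eq_zero]
    exact hq.symm
  rw [sub_eq_zero.mp hfq]
  exact hq.symm
end

section
/- Let V be a compact Hausdorff space and let p be a continuous Hermitian quasilinear functional on C(V, ℍ). Then there exist continuous positive quasilinear functionals p⁺ and p⁻ on C(V, ℍ) such that p = p⁺ − p⁻ and ‖p‖ = ‖p⁺‖ + ‖p⁻‖ = p⁺(1) + p⁻(1), where the norms are operator norms and p⁺(1), p⁻(1) are the (real) values at the constant function 1. -/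
local notation "ℍ" => Quaternion ℝ

/-- A continuous functional `φ` on `C(V, ℝ)` is a difference of two positive functionals whose
values at `1` add up to at most `‖φ‖`. -/
theorem exists_positive_sub_positive {V : Type*} [TopologicalSpace V] [CompactSpace V]
    (φ : C(V, ℝ) →L[ℝ] ℝ) :
    ∃ μ ν : C(V, ℝ) →ₗ[ℝ] ℝ, (∀ f, 0 ≤ f → 0 ≤ μ f) ∧ (∀ f, 0 ≤ f → 0 ≤ ν f) ∧
      (∀ f, φ f = μ f - ν f) ∧ μ 1 + ν 1 ≤ ‖φ‖ := by
  let dom : Submodule ℝ (C(V, ℝ) × C(V, ℝ)) :=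
    LinearMap.ker (LinearMap.fst ℝ C(V, ℝ) C(V, ℝ) + LinearMap.snd ℝ C(V, ℝ) C(V, ℝ))
  let F : (C(V, ℝ) × C(V, ℝ)) →ₗ.[ℝ] ℝ :=
    ⟨dom, φ.toLinearMap ∘ₗ LinearMap.fst ℝ C(V, ℝ) C(V, ℝ) ∘ₗ dom.subtype⟩
  let N : C(V, ℝ) × C(V, ℝ) → ℝ := fun x => ‖φ‖ * ‖x.1 ⊔ x.2 ⊔ 0‖
  have bound (x : C(V, ℝ) × C(V, ℝ)) (v : V) : max (max (x.1 v) (x.2 v)) 0 ≤ ‖x.1 ⊔ x.2 ⊔ 0‖ :=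
    (le_abs_self _).trans ((x.1 ⊔ x.2 ⊔ 0).norm_coe_le_norm v)
  have norm_le_of (x : C(V, ℝ) × C(V, ℝ)) (C : ℝ) (hC : 0 ≤ C)
      (h : ∀ v, x.1 v ≤ C ∧ x.2 v ≤ C) : ‖x.1 ⊔ x.2 ⊔ 0‖ ≤ C := by
    refine (ContinuousMap.norm_le _ hC).2 fun v => ?_
    change |max (max (x.1 v) (x.2 v)) 0| ≤ C
    rw [abs_of_nonneg (le_max_right _ _)]
    exact max_le (max_le (h v).1 (h v).2) hC
  have N_hom (c : ℝ) (hc : 0 < c) (x) : N (c • x) = c * N x := by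
    have : (c • x).1 ⊔ (c • x).2 ⊔ 0 = c • (x.1 ⊔ x.2 ⊔ 0) := by
      ext v
      change max (max (c * x.1 v) (c * x.2 v)) 0 = c * max (max (x.1 v) (x.2 v)) 0
      rw [mul_max_of_nonneg _ _ hc.le, mul_max_of_nonneg _ _ hc.le, mul_zero]
    simp only [N, this, norm_smul, Real.norm_of_nonneg hc.le]
    ring
  have N_add (x y) : N (x + y) ≤ N x + N y := by
    simp only [N, ← mul_add]
    refine mul_le_mul_of_nonneg_left ?_ (norm_nonneg φ)
    refine norm_le_of (x + y) _ (by positivity) fun v => ?_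
    have hx := bound x v
    have hy := bound y v
    simp only [max_le_iff] at hx hy
    exact ⟨add_le_add hx.1.1 hy.1.1, add_le_add hx.1.2 hy.1.2⟩
  obtain ⟨G, hG, hGN⟩ := exists_extension_of_le_sublinear F N N_hom N_add (by
    rintro ⟨⟨f, g⟩, hx⟩
    have hfg : f + g = 0 := hx
    obtain rfl : g = -f := (neg_eq_of_add_eq_zero_right hfg).symm
    change φ f ≤ ‖φ‖ * ‖f ⊔ -f ⊔ 0‖
    refine (le_abs_self _).trans ((φ.le_opNorm f).trans ?_)
    refine mul_le_mul_of_nonneg_left ?_ (norm_nonneg _)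
    refine (ContinuousMap.norm_le _ (norm_nonneg _)).2 fun v => ?_
    exact (le_max_left _ _).trans (bound (f, -f) v))
  have G_nonneg (x : C(V, ℝ) × C(V, ℝ)) (hx : 0 ≤ x) : 0 ≤ G x := by
    have h1 := hGN (-x)
    have h2 : ‖(-x).1 ⊔ (-x).2 ⊔ 0‖ ≤ 0 := norm_le_of (-x) 0 le_rfl fun v =>
      ⟨neg_nonpos.2 (hx.1 v), neg_nonpos.2 (hx.2 v)⟩
    have h3 : N (-x) ≤ 0 := mul_nonpos_of_nonneg_of_nonpos (norm_nonneg φ) h2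
    rw [map_neg] at h1
    linarith
  refine ⟨G ∘ₗ LinearMap.inl ℝ _ _, G ∘ₗ LinearMap.inr ℝ _ _, fun f hf => G_nonneg _ ⟨hf, le_rfl⟩,
    fun f hf => G_nonneg _ ⟨le_rfl, hf⟩, fun f => ?_, ?_⟩
  · have h : ((f, -f) : C(V, ℝ) × C(V, ℝ)) ∈ dom := add_neg_cancel f
    have h2 : G (f, -f) = φ f := hG ⟨_, h⟩
    rw [← h2]
    simp [← map_sub]
  · have h : G (1, 1) ≤ ‖φ‖ := by
      refine (hGN _).trans (mul_le_of_le_one_right (norm_nonneg φ) ?_)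
      exact norm_le_of (1, 1) 1 zero_le_one fun v => ⟨le_rfl, le_rfl⟩
    simpa [← map_add] using h

section VectorExtension

variable {V ι E : Type*} [TopologicalSpace V] [Fintype ι] [NormedAddCommGroup E]
  [InnerProductSpace ℝ E]

/-- The pairing of a vector-valued function with a fixed vector. -/
noncomputable def innerFun (u : E) (f : C(V, E)) : C(V, ℝ) :=
  (innerSL ℝ u).compLeftContinuous ℝ V f

theorem innerFun_apply (u : E) (f : C(V, E)) (v : V) : innerFun u f v = inner ℝ u (f v) := rfl

/-- The function `v ↦ g v • c`. -/
def smulConst (g : C(V, ℝ)) (c : E) : C(V, E) := ⟨fun v => g v • c, by fun_prop⟩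

theorem smulConst_apply (g : C(V, ℝ)) (c : E) (v : V) : smulConst g c v = g v • c := rfl

/-- The coordinatewise extension of a functional on `C(V, ℝ)` to `E`-valued functions. -/
noncomputable def vectorExtension (b : OrthonormalBasis ι ℝ E) (μ : C(V, ℝ) →ₗ[ℝ] ℝ) :
    C(V, E) →ₗ[ℝ] E :=
  ∑ i, LinearMap.toSpanSingleton ℝ E (b i) ∘ₗ μ ∘ₗ
    ((innerSL ℝ (b i)).compLeftContinuous ℝ V).toLinearMap

theorem vectorExtension_apply (b : OrthonormalBasis ι ℝ E) (μ : C(V, ℝ) →ₗ[ℝ] ℝ) (f : C(V, E)) :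
    vectorExtension b μ f = ∑ i, μ (innerFun (b i) f) • b i := by
  simp [vectorExtension, innerFun]

theorem inner_vectorExtension (b : OrthonormalBasis ι ℝ E) (μ : C(V, ℝ) →ₗ[ℝ] ℝ) (u : E)
    (f : C(V, E)) : inner ℝ u (vectorExtension b μ f) = μ (innerFun u f) := by
  have h : innerFun u f = ∑ i, inner ℝ u (b i) • innerFun (b i) f := by
    ext v
    simp only [innerFun_apply, ContinuousMap.coe_sum, Finset.sum_apply, ContinuousMap.coe_smul,
      Pi.smul_apply, smul_eq_mul]
    exact (b.sum_inner_mul_inner u (f v)).symm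
  simp [h, vectorExtension_apply, inner_sum, inner_smul_right, mul_comm]

theorem vectorExtension_smulConst (b : OrthonormalBasis ι ℝ E) (μ : C(V, ℝ) →ₗ[ℝ] ℝ)
    (g : C(V, ℝ)) (c : E) : vectorExtension b μ (smulConst g c) = μ g • c := by
  refine ext_inner_left ℝ fun u => ?_
  have h : innerFun u (smulConst g c) = inner ℝ u c • g := by
    ext v
    simp [innerFun_apply, smulConst_apply, inner_smul_right, mul_comm]
  rw [inner_vectorExtension, h, map_smul, inner_smul_right, smul_eq_mul, mul_comm]

theorem sum_smulConst_innerFun (b : OrthonormalBasis ι ℝ E) (f : C(V, E)) :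
    ∑ i, smulConst (innerFun (b i) f) (b i) = f := by
  ext v
  simpa [smulConst_apply, innerFun_apply] using b.sum_repr' (f v)

theorem norm_vectorExtension_le [CompactSpace V] (b : OrthonormalBasis ι ℝ E)
    {μ : C(V, ℝ) →ₗ[ℝ] ℝ} (hμ : ∀ f, 0 ≤ f → 0 ≤ μ f) (f : C(V, E)) :
    ‖vectorExtension b μ f‖ ≤ μ 1 * ‖f‖ := by
  set w := vectorExtension b μ f with hw
  have h1 : ‖w‖ * ‖w‖ = μ (innerFun w f) := by
    rw [← real_inner_self_eq_norm_mul_norm, ← inner_vectorExtension b μ w f]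
  have h2 : 0 ≤ μ ((‖w‖ * ‖f‖) • 1 - innerFun w f) := hμ _ fun v => by
    have h := (real_inner_le_norm w (f v)).trans
      (mul_le_mul_of_nonneg_left (f.norm_coe_le_norm v) (norm_nonneg w))
    simpa [innerFun_apply] using h
  rw [map_sub, map_smul, smul_eq_mul] at h2
  rcases (norm_nonneg w).eq_or_lt with h | h
  · rw [← h]
    exact mul_nonneg (hμ _ zero_le_one) (norm_nonneg _)
  · refine le_of_mul_le_mul_left ?_ h
    linarith

end VectorExtension

/-- The orthonormal basis `1, i, j, k` of the quaternions. -/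
noncomputable def quaternionBasis : OrthonormalBasis (Fin 4) ℝ (Quaternion ℝ) :=
  .ofRepr Quaternion.linearIsometryEquivTuple

theorem quaternionBasis_mem (i : Fin 4) : quaternionBasis i ∈
    ({1, ⟨0, 1, 0, 0⟩, ⟨0, 0, 1, 0⟩, ⟨0, 0, 0, 1⟩} : Set (Quaternion ℝ)) := by
  have h : quaternionBasis i =
      (Quaternion.equivTuple ℝ).symm (EuclideanSpace.single i (1 : ℝ)) := by
    rw [← OrthonormalBasis.repr_symm_single]
    rfl
  rw [h]
  fin_cases i
  · left; ext <;> simp <;> rfl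
  · right; left; ext <;> simp
  · right; right; left; ext <;> simp
  · right; right; right; ext <;> simp

/-- The linear map which is the identity on real quaternions and `ε • T` on imaginary ones. -/
noncomputable def scaleIm (T : Quaternion ℝ →L[ℝ] Quaternion ℝ) (ε : ℝ) :
    Quaternion ℝ →ₗ[ℝ] Quaternion ℝ where
  toFun x := x.re + ε • T x.im
  map_add' x y := by
    simp only [Quaternion.re_add, Quaternion.im_add, Quaternion.coe_add, map_add, smul_add]
    abel
  map_smul' c x := by
    simp only [Quaternion.re_smul, Quaternion.im_smul, map_smul, RingHom.id_apply, smul_add,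
      Quaternion.coe_smul, smul_comm c ε]

theorem scaleIm_apply (T : Quaternion ℝ →L[ℝ] Quaternion ℝ) (ε : ℝ) (x : Quaternion ℝ) :
    scaleIm T ε x = x.re + ε • T x.im := rfl

theorem scaleIm_one (T : Quaternion ℝ →L[ℝ] Quaternion ℝ) (ε : ℝ) : scaleIm T ε 1 = 1 := by
  have h : (1 : Quaternion ℝ).im = 0 := by ext <;> rfl
  rw [scaleIm_apply, h, map_zero, smul_zero, add_zero]
  rfl

theorem norm_sq_re_add {r : ℝ} {y : Quaternion ℝ} (hy : y.re = 0) :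
    ‖(r : Quaternion ℝ) + y‖ ^ 2 = r ^ 2 + ‖y‖ ^ 2 := by
  simp only [sq ‖_‖, ← Quaternion.normSq_eq_norm_mul_self, Quaternion.normSq_def', hy]
  simp [hy]
  ring

theorem norm_scaleIm_le {T : Quaternion ℝ →L[ℝ] Quaternion ℝ}
    (hT : ∀ y : Quaternion ℝ, y.re = 0 → (T y).re = 0) {ε : ℝ} (hε : |ε| * ‖T‖ ≤ 1)
    (x : Quaternion ℝ) : ‖scaleIm T ε x‖ ≤ ‖x‖ := by
  have h0 : x.im.re = 0 := by simp
  refine le_of_sq_le_sq ?_ (norm_nonneg _)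
  rw [scaleIm_apply, norm_sq_re_add (by simp [hT _ h0])]
  conv_rhs => rw [← Quaternion.re_add_im x, norm_sq_re_add h0]
  gcongr
  calc ‖ε • T x.im‖ = |ε| * ‖T x.im‖ := by rw [norm_smul, Real.norm_eq_abs]
    _ ≤ |ε| * (‖T‖ * ‖x.im‖) := by gcongr; exact T.le_opNorm _
    _ = |ε| * ‖T‖ * ‖x.im‖ := by ring
    _ ≤ ‖x.im‖ := mul_le_of_le_one_left (norm_nonneg _) hε

/-- Jordan decomposition of the quaternion-valued operator `T ∘ vectorExtension φ`. -/
theorem exists_jordan_decomposition {V : Type*} [TopologicalSpace V] [CompactSpace V]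
    {p : C(V, Quaternion ℝ) →L[ℝ] Quaternion ℝ} {φ : C(V, ℝ) →L[ℝ] ℝ}
    {T : Quaternion ℝ →L[ℝ] Quaternion ℝ}
    (hp : ∀ f, p f = T (vectorExtension quaternionBasis φ.toLinearMap f)) (hT1 : T 1 = 1)
    (hT : ∀ y : Quaternion ℝ, y.re = 0 → (T y).re = 0) :
    ∃ pp pm : C(V, Quaternion ℝ) →L[ℝ] Quaternion ℝ,
      (∀ g : C(V, ℝ), 0 ≤ g →
        ∃ r : ℝ, 0 ≤ r ∧ pp (smulConst g 1) = algebraMap ℝ (Quaternion ℝ) r) ∧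
      (∀ g : C(V, ℝ), 0 ≤ g →
        ∃ r : ℝ, 0 ≤ r ∧ pm (smulConst g 1) = algebraMap ℝ (Quaternion ℝ) r) ∧
      p = pp - pm ∧ ‖p‖ = ‖pp‖ + ‖pm‖ ∧ pp 1 + pm 1 = algebraMap ℝ (Quaternion ℝ) ‖p‖ := by
  obtain ⟨μ, ν, hμ, hν, hφ, hle⟩ := exists_positive_sub_positive φ
  set M := ‖T‖ with hM
  have hM1 : 1 ≤ M := by simpa [hT1] using T.le_opNorm 1
  have hM0 : 0 < M := by linarith
  have hpos : |M⁻¹| * ‖T‖ ≤ 1 := by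
    rw [abs_of_pos (inv_pos.2 hM0), ← hM, inv_mul_cancel₀ hM0.ne']
  have hneg : |-M⁻¹| * ‖T‖ ≤ 1 := by rwa [abs_neg]
  set a := (M + 1) / 2 with ha
  set c := (M - 1) / 2 with hc
  have ha0 : 0 ≤ a := by rw [ha]; linarith
  have hc0 : 0 ≤ c := by rw [hc]; linarith
  -- The two parts have the same shape, with the roles of the positive functionals exchanged.
  have build (α β : C(V, ℝ) →ₗ[ℝ] ℝ) (hα : ∀ f, 0 ≤ f → 0 ≤ α f) (hβ : ∀ f, 0 ≤ f → 0 ≤ β f) :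
      ∃ q : C(V, Quaternion ℝ) →L[ℝ] Quaternion ℝ,
        (∀ f, q f = a • scaleIm T M⁻¹ (vectorExtension quaternionBasis α f) +
          c • scaleIm T (-M⁻¹) (vectorExtension quaternionBasis β f)) ∧
        (∀ g : C(V, ℝ), q (smulConst g 1) = algebraMap ℝ (Quaternion ℝ) (a * α g + c * β g)) ∧
        ‖q‖ ≤ a * α 1 + c * β 1 := by
    let L : C(V, Quaternion ℝ) →ₗ[ℝ] Quaternion ℝ :=
      a • (scaleIm T M⁻¹ ∘ₗ vectorExtension quaternionBasis α) +
        c • (scaleIm T (-M⁻¹) ∘ₗ vectorExtension quaternionBasis β)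
    have hL (f) : ‖L f‖ ≤ (a * α 1 + c * β 1) * ‖f‖ := by
      calc ‖L f‖ ≤ ‖a • scaleIm T M⁻¹ (vectorExtension quaternionBasis α f)‖ +
            ‖c • scaleIm T (-M⁻¹) (vectorExtension quaternionBasis β f)‖ := norm_add_le _ _
        _ ≤ a * (α 1 * ‖f‖) + c * (β 1 * ‖f‖) := by
          rw [norm_smul, norm_smul, Real.norm_of_nonneg ha0, Real.norm_of_nonneg hc0]
          gcongr
          · exact (norm_scaleIm_le hT hpos _).trans (norm_vectorExtension_le _ hα f)
          · exact (norm_scaleIm_le hT hneg _).trans (norm_vectorExtension_le _ hβ f)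
        _ = _ := by ring
    refine ⟨L.mkContinuous _ hL, fun f => rfl, fun g => ?_, L.mkContinuous_norm_le ?_ hL⟩
    · change a • scaleIm T M⁻¹ (vectorExtension quaternionBasis α _) +
          c • scaleIm T (-M⁻¹) (vectorExtension quaternionBasis β _) = _
      simp only [vectorExtension_smulConst, map_smul, scaleIm_one, smul_smul, ← add_smul,
        Algebra.algebraMap_eq_smul_one]
    · exact add_nonneg (mul_nonneg ha0 (hα _ zero_le_one)) (mul_nonneg hc0 (hβ _ zero_le_one))
  obtain ⟨pp, hpp, hpp1, hppn⟩ := build μ ν hμ hν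
  obtain ⟨pm, hpm, hpm1, hpmn⟩ := build ν μ hν hμ
  have hT_eq (x : Quaternion ℝ) : T x = a • scaleIm T M⁻¹ x - c • scaleIm T (-M⁻¹) x := by
    have h : T x = x.re + T x.im := by
      conv_lhs => rw [← Quaternion.re_add_im x, map_add]
      congr 1
      rw [← Quaternion.algebraMap_def, Algebra.algebraMap_eq_smul_one, map_smul, hT1]
    have h1 : a - c = 1 := by rw [ha, hc]; ring
    have h2 : (a + c) * M⁻¹ = 1 := by
      rw [ha, hc]; field_simp; ring
    rw [h, scaleIm_apply, scaleIm_apply]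
    calc (x.re : Quaternion ℝ) + T x.im
        = (a - c) • (x.re : Quaternion ℝ) + ((a + c) * M⁻¹) • T x.im := by
          rw [h1, h2, one_smul, one_smul]
      _ = _ := by module
  have hsub : p = pp - pm := by
    ext1 f
    have h : vectorExtension quaternionBasis φ.toLinearMap f =
        vectorExtension quaternionBasis μ f - vectorExtension quaternionBasis ν f := by
      simp [vectorExtension_apply, hφ, sub_smul]
    rw [hp, h, map_sub, hT_eq, hT_eq, sub_apply, hpp, hpm]
    abel
  have hlow : ‖φ‖ * M ≤ ‖p‖ := by
    have h1 (g : C(V, ℝ)) (u : Quaternion ℝ) : ‖φ g‖ * ‖T u‖ ≤ ‖p‖ * ‖g‖ * ‖u‖ := by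
      have h : p (smulConst g u) = φ g • T u := by
        rw [hp, vectorExtension_smulConst, map_smul]; rfl
      rw [← norm_smul, ← h, mul_assoc]
      refine (p.le_opNorm _).trans ?_
      gcongr
      refine (ContinuousMap.norm_le _ (by positivity)).2 fun v => ?_
      rw [smulConst_apply, norm_smul]
      gcongr
      exact g.norm_coe_le_norm v
    have h2 (u : Quaternion ℝ) : ‖φ‖ * ‖T u‖ ≤ ‖p‖ * ‖u‖ := by
      rcases (norm_nonneg (T u)).eq_or_lt with h | h
      · rw [← h, mul_zero]
        positivity
      · rw [← le_div_iff₀ h]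
        refine φ.opNorm_le_bound (by positivity) fun g => ?_
        rw [div_mul_eq_mul_div, le_div_iff₀ h]
        exact (h1 g u).trans_eq (mul_right_comm _ _ _)
    rcases (norm_nonneg φ).eq_or_lt with h | h
    · rw [← h, zero_mul]
      positivity
    · rw [← le_div_iff₀' h]
      refine T.opNorm_le_bound (by positivity) fun u => ?_
      rw [div_mul_eq_mul_div, le_div_iff₀' h]
      exact h2 u
  have htri : ‖p‖ ≤ ‖pp‖ + ‖pm‖ := hsub ▸ norm_sub_le pp pm
  have hval : (a * μ 1 + c * ν 1) + (a * ν 1 + c * μ 1) = (μ 1 + ν 1) * M := by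
    rw [ha, hc]; ring
  have hup : (μ 1 + ν 1) * M ≤ ‖φ‖ * M := mul_le_mul_of_nonneg_right hle hM0.le
  refine ⟨pp, pm, fun g hg => ⟨_, ?_, hpp1 g⟩, fun g hg => ⟨_, ?_, hpm1 g⟩, hsub, by linarith, ?_⟩
  · exact add_nonneg (mul_nonneg ha0 (hμ _ hg)) (mul_nonneg hc0 (hν _ hg))
  · exact add_nonneg (mul_nonneg ha0 (hν _ hg)) (mul_nonneg hc0 (hμ _ hg))
  · have h1 : (1 : C(V, Quaternion ℝ)) = smulConst 1 1 := by ext1 v; simp [smulConst_apply]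
    rw [h1, hpp1, hpm1, ← map_add]
    congr 1
    linarith

/-- Jordan decomposition of a continuous Hermitian quasilinear functional `p` on
`C(V, ℍ)` (`V` compact Hausdorff): `p = p⁺ − p⁻` with `p⁺, p⁻` continuous positive
quasilinear functionals and `‖p‖ = ‖p⁺‖ + ‖p⁻‖ = p⁺(1) + p⁻(1)`. -/
theorem stmt_18 {V : Type*} [TopologicalSpace V] [CompactSpace V] [T2Space V]
    (p : ContinuousMap V ℍ →L[ℝ] ℍ)
    (hherm : ∀ f g : ContinuousMap V ℍ, (∀ v, g v = star (f v)) → p g = star (p f))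
    (hgen : ∀ f : ContinuousMap V ℍ, (∀ v, ∃ r : ℝ, f v = algebraMap ℝ ℍ r) →
      ∀ c ∈ ({1, ⟨0, 1, 0, 0⟩, ⟨0, 0, 1, 0⟩, ⟨0, 0, 0, 1⟩} : Set ℍ),
        p (f * ContinuousMap.const V c) = p f * p (ContinuousMap.const V c)) :
    ∃ pp pm : ContinuousMap V ℍ →L[ℝ] ℍ,
      (∀ f : ContinuousMap V ℍ, (∀ v, ∃ r : ℝ, 0 ≤ r ∧ f v = algebraMap ℝ ℍ r) →
        ∃ r : ℝ, 0 ≤ r ∧ pp f = algebraMap ℝ ℍ r) ∧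
      (∀ f : ContinuousMap V ℍ, (∀ v, ∃ r : ℝ, 0 ≤ r ∧ f v = algebraMap ℝ ℍ r) →
        ∃ r : ℝ, 0 ≤ r ∧ pm f = algebraMap ℝ ℍ r) ∧
      p = pp - pm ∧
      ‖p‖ = ‖pp‖ + ‖pm‖ ∧
      pp 1 + pm 1 = algebraMap ℝ ℍ ‖p‖ := by
  have hreal {q : ℍ} (h : star q = q) : q = q.re := Quaternion.star_eq_self.1 h
  have hlift (g : C(V, ℝ)) (c : ℍ) (hc : c ∈ ({1, ⟨0, 1, 0, 0⟩, ⟨0, 0, 1, 0⟩, ⟨0, 0, 0, 1⟩} : Set ℍ)) :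
      p (smulConst g c) = p (smulConst g 1) * p (ContinuousMap.const V c) := by
    rw [← hgen (smulConst g 1) (fun v => ⟨g v, by
      rw [smulConst_apply, Algebra.algebraMap_eq_smul_one]⟩) c hc]
    congr 1
    ext1 v
    simp [smulConst_apply]
  have hself (g : C(V, ℝ)) : p (smulConst g 1) = (p (smulConst g 1)).re :=
    hreal (hherm _ _ fun v => by simp [smulConst_apply]).symm
  have hone : smulConst (1 : C(V, ℝ)) (1 : ℍ) = 1 := by ext1 v; simp [smulConst_apply]
  have hconst : ContinuousMap.const V (1 : ℍ) = 1 := rfl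
  have hidem (g : C(V, ℝ)) : p (smulConst g 1) = p (smulConst g 1) * p 1 := by
    simpa only [hconst] using hlift g 1 (by simp)
  have hp1 : p 1 = 0 ∨ p 1 = 1 := by
    have h := hidem 1
    rw [hone] at h
    exact (IsIdempotentElem.iff_eq_zero_or_one).1 h.symm
  rcases hp1 with h0 | h1
  · have hp0 : p = 0 := by
      ext1 f
      rw [← sum_smulConst_innerFun quaternionBasis f, map_sum]
      refine Finset.sum_eq_zero fun i _ => ?_
      rw [hlift _ _ (quaternionBasis_mem i), hidem, h0, mul_zero, zero_mul]
    exact ⟨0, 0, fun f _ => ⟨0, le_rfl, by simp⟩, fun f _ => ⟨0, le_rfl, by simp⟩, by simp [hp0],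
      by simp only [hp0, ContinuousLinearMap.opNorm_zero, add_zero],
      by simp only [hp0, ContinuousLinearMap.opNorm_zero, zero_apply, add_zero, map_zero]⟩
  let T : ℍ →L[ℝ] ℍ :=
    ((p.toLinearMap ∘ₗ
      { toFun := ContinuousMap.const V
        map_add' := fun _ _ => rfl
        map_smul' := fun _ _ => rfl } : ℍ →ₗ[ℝ] ℍ)).toContinuousLinearMap
  have hT_apply (u : ℍ) : T u = p (ContinuousMap.const V u) := rfl
  let φ₀ : C(V, ℝ) →ₗ[ℝ] ℝ :=
    { toFun := fun g => (p (smulConst g 1)).re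
      map_add' := fun f g => by
        rw [← Quaternion.re_add, ← map_add]
        congr 2
        ext1 v
        exact add_smul _ _ _
      map_smul' := fun c g => by
        rw [RingHom.id_apply, ← Quaternion.re_smul, ← map_smul]
        congr 2
        ext1 v
        exact mul_smul _ _ _ }
  let φ : C(V, ℝ) →L[ℝ] ℝ := φ₀.mkContinuous ‖p‖ fun g => by
    change ‖(p (smulConst g 1)).re‖ ≤ _
    rw [← Quaternion.norm_coe, ← hself]
    refine (p.le_opNorm _).trans ?_
    gcongr
    refine (ContinuousMap.norm_le _ (by positivity)).2 fun v => ?_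
    rw [smulConst_apply, norm_smul, norm_one, mul_one]
    exact g.norm_coe_le_norm v
  have hφ (g : C(V, ℝ)) : p (smulConst g 1) = (φ g : ℍ) := hself g
  obtain ⟨pp, pm, hpp, hpm, hrest⟩ := exists_jordan_decomposition (p := p) (φ := φ) (T := T)
    (fun f => by
      rw [vectorExtension_apply, map_sum]
      conv_lhs => rw [← sum_smulConst_innerFun quaternionBasis f, map_sum]
      refine Finset.sum_congr rfl fun i _ => ?_
      rw [hlift _ _ (quaternionBasis_mem i), hφ, Quaternion.coe_mul_eq_smul, map_smul, hT_apply]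
      rfl)
    (by rw [hT_apply, hconst, h1])
    (fun y hy => by
      rw [← Quaternion.star_eq_neg] at hy ⊢
      rw [← map_neg, ← hy, hT_apply, hT_apply]
      exact (hherm _ _ fun v => rfl).symm)
  have hform (f : ContinuousMap V ℍ) (hf : ∀ v, ∃ r : ℝ, 0 ≤ r ∧ f v = algebraMap ℝ ℍ r) :
      ∃ g : C(V, ℝ), 0 ≤ g ∧ f = smulConst g 1 := by
    refine ⟨⟨fun v => (f v).re, Quaternion.continuous_re.comp f.continuous⟩, fun v => ?_, ?_⟩
    · obtain ⟨r, hr, h⟩ := hf v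
      change 0 ≤ (f v).re
      simpa [h] using hr
    · ext1 v
      obtain ⟨r, hr, h⟩ := hf v
      change f v = (f v).re • (1 : ℍ)
      rw [h, ← Algebra.algebraMap_eq_smul_one]
      simp
  refine ⟨pp, pm, fun f hf => ?_, fun f hf => ?_, hrest⟩
  · obtain ⟨g, hg, rfl⟩ := hform f hf
    exact hpp g hg
  · obtain ⟨g, hg, rfl⟩ := hform f hf
    exact hpm g hg
end

section
/- Let V be a compact Hausdorff space and let 𝒜 ⊆ C(V, ℍ) be a norm-closed subring such that: the constant function 1 belongs to 𝒜; 𝒜 is closed under the pointwise involution f ↦ star ∘ f; 𝒜 is closed under left and right multiplication by quaternion constants (for every c ∈ ℍ and f ∈ 𝒜, both v ↦ c·f(v) and v ↦ f(v)·c lie in 𝒜); and 𝒜 separates points (for every pair of distinct points v₀, v₁ ∈ V there exists f ∈ 𝒜 with f(v₀) ≠ f(v₁)). Then 𝒜 = C(V, ℍ). -/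
local notation "ℍ" => Quaternion ℝ

/-- The quaternion `a + b i + c j + d k`. -/
def ofCoords (a b c d : ℝ) : ℍ := ⟨a, b, c, d⟩

@[simp] theorem re_ofCoords (a b c d : ℝ) : (ofCoords a b c d).re = a := rfl
@[simp] theorem imI_ofCoords (a b c d : ℝ) : (ofCoords a b c d).imI = b := rfl
@[simp] theorem imJ_ofCoords (a b c d : ℝ) : (ofCoords a b c d).imJ = c := rfl
@[simp] theorem imK_ofCoords (a b c d : ℝ) : (ofCoords a b c d).imK = d := rfl

/-- The inclusion of `C(V, ℝ)` into `C(V, ℍ)`. -/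
noncomputable def realInclusion (V : Type*) [TopologicalSpace V] :
    C(V, ℝ) →ₐ[ℝ] C(V, ℍ) :=
  (Algebra.ofId ℝ ℍ).compLeftContinuous ℝ (continuous_algebraMap ℝ ℍ)

theorem realInclusion_apply {V : Type*} [TopologicalSpace V] (g : C(V, ℝ)) (v : V) :
    realInclusion V g v = (g v : ℍ) := rfl

theorem continuous_realInclusion (V : Type*) [TopologicalSpace V] :
    Continuous (realInclusion V) :=
  ContinuousMap.continuous_postcomp ⟨_, continuous_algebraMap ℝ ℍ⟩

/-- The real part of a quaternion-valued continuous function. -/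
noncomputable def rePart {V : Type*} [TopologicalSpace V] (f : C(V, ℍ)) : C(V, ℝ) :=
  ⟨fun v => (f v).re, Quaternion.continuous_re.comp f.continuous⟩

/-- A quaternion-valued function is recovered from the real parts of `f`, `i f`, `j f`, `k f`. -/
theorem eq_sum_const_mul_rePart {V : Type*} [TopologicalSpace V] (f : C(V, ℍ)) :
    f = realInclusion V (rePart f)
      - ContinuousMap.const V (ofCoords 0 1 0 0) *
          realInclusion V (rePart (ContinuousMap.const V (ofCoords 0 1 0 0) * f))
      - ContinuousMap.const V (ofCoords 0 0 1 0) *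
          realInclusion V (rePart (ContinuousMap.const V (ofCoords 0 0 1 0) * f))
      - ContinuousMap.const V (ofCoords 0 0 0 1) *
          realInclusion V (rePart (ContinuousMap.const V (ofCoords 0 0 0 1) * f)) := by
  ext v <;> simp [realInclusion_apply, rePart]

/-- Quaternionic Stone–Weierstrass theorem: a norm-closed subring of `C(V, ℍ)`
(`V` compact Hausdorff) containing the constants' unit, closed under the pointwise
involution and under left and right multiplication by quaternion constants, and
separating the points of `V`, is all of `C(V, ℍ)`. -/
theorem stmt_19 {V : Type*} [TopologicalSpace V] [CompactSpace V] [T2Space V]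
    (A : Subring (ContinuousMap V ℍ))
    (hclosed : IsClosed (A : Set (ContinuousMap V ℍ)))
    (hstar : ∀ f ∈ A, ∀ g : ContinuousMap V ℍ, (∀ v, g v = star (f v)) → g ∈ A)
    (hconst : ∀ (c : ℍ), ∀ f ∈ A,
      (ContinuousMap.const V c * f) ∈ A ∧ (f * ContinuousMap.const V c) ∈ A)
    (hsep : ∀ v₀ v₁ : V, v₀ ≠ v₁ → ∃ f ∈ A, f v₀ ≠ f v₁) :
    A = ⊤ := by
  have hscalar (r : ℝ) : algebraMap ℝ C(V, ℍ) r ∈ A := by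
    have h : algebraMap ℝ C(V, ℍ) r = ContinuousMap.const V (r : ℍ) * 1 := by
      rw [mul_one]
      rfl
    rw [h]
    exact (hconst _ 1 A.one_mem).1
  let S : Subalgebra ℝ C(V, ℍ) := { A with algebraMap_mem' := hscalar }
  let B : Subalgebra ℝ C(V, ℝ) := S.comap (realInclusion V)
  have hre (f : C(V, ℍ)) (hf : f ∈ A) : rePart f ∈ B := by
    change realInclusion V (rePart f) ∈ A
    have h : realInclusion V (rePart f) =
        ContinuousMap.const V (ofCoords 2⁻¹ 0 0 0) * (f + star f) := by
      ext v <;> simp [realInclusion_apply, rePart]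
      ring
    rw [h]
    exact (hconst _ _ (A.add_mem hf (hstar f hf (star f) fun _ => rfl))).1
  have hBsep : B.SeparatesPoints := by
    intro v w hvw
    obtain ⟨f, hf, hne⟩ := hsep v w hvw
    by_contra! h
    have hB (g : C(V, ℝ)) (hg : g ∈ B) : g v = g w := h g ⟨g, hg, rfl⟩
    have hmul (c : ℍ) : (c * f v).re = (c * f w).re :=
      hB _ (hre _ (hconst c f hf).1)
    have h0 := hmul 1
    have h1 := hmul (ofCoords 0 1 0 0)
    have h2 := hmul (ofCoords 0 0 1 0)
    have h3 := hmul (ofCoords 0 0 0 1)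
    simp at h0 h1 h2 h3
    exact hne (QuaternionAlgebra.ext h0 h1 h2 h3)
  have hBclosed : IsClosed (B : Set C(V, ℝ)) := hclosed.preimage (continuous_realInclusion V)
  have hBtop (g : C(V, ℝ)) : realInclusion V g ∈ A := by
    have hg : g ∈ closure (B : Set C(V, ℝ)) :=
      ContinuousMap.continuousMap_mem_subalgebra_closure_of_separatesPoints B hBsep g
    rw [hBclosed.closure_eq] at hg
    exact hg
  refine eq_top_iff.2 fun f _ => ?_
  rw [eq_sum_const_mul_rePart f]
  exact A.sub_mem (A.sub_mem (A.sub_mem (hBtop _) (hconst _ _ (hBtop _)).1)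
    (hconst _ _ (hBtop _)).1) (hconst _ _ (hBtop _)).1
end
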